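/- Let S be the natural coding of a linear involution without connection on the alphabet A. For every nonempty word w ∈ S, the set MR_S(w) of mixed first return words to w is a symmetric basis of the free group F_A on A. -/

import Mathlib

open Set

namespace LinInv

/-- A letter of the extended alphabet `A ∪ A⁻¹`, encoded as a pair of a letter
of `A` and a sign. -/
abbrev Letter (A : Type*) := A × Bool

/-- The formal inverse of a letter. -/
def Letter.inv {A : Type*} (c : Letter A) : Letter A := (c.1, !c.2)

/-- The inverse of a word over `A ∪ A⁻¹`. -/
def wordInv {A : Type*} (u : List (Letter A)) : List (Letter A) :=
  (u.map Letter.inv).reverse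

/-- The involution `σ₂` exchanging the two components of `Î = I × {0,1}`. -/
def s2 (z : ℝ × Bool) : ℝ × Bool := (z.1, !z.2)

/-- A linear involution on the alphabet `A`: the open interval `I = ]lo,hi[`,
for each `c ∈ A ∪ A⁻¹` an open subinterval `I_c = ]endLo c, endHi c[ × {comp c}`
of one of the two components of `Î = I × {0,1}`, the finite set `Sig` of division
points, and the first involution `σ₁`, subject to the defining conditions. -/
structure LinearInvolution (A : Type*) [Fintype A] where
  lo : ℝ
  hi : ℝ
  lo_lt_hi : lo < hi
  endLo : Letter A → ℝ
  endHi : Letter A → ℝ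
  end_lt : ∀ c, endLo c < endHi c
  comp : Letter A → Bool
  sub_lo : ∀ c, lo ≤ endLo c
  sub_hi : ∀ c, endHi c ≤ hi
  /-- the length data satisfy `λ_a = λ_{a⁻¹}` -/
  len_inv : ∀ c, endHi c - endLo c = endHi (Letter.inv c) - endLo (Letter.inv c)
  /-- the set of division points -/
  Sig : Set (ℝ × Bool)
  Sig_sub : Sig ⊆ Ioo lo hi ×ˢ (univ : Set Bool)
  /-- there are `2k-2` division points -/
  Sig_card : Sig.ncard = 2 * Fintype.card A - 2
  /-- the intervals `I_c` are pairwise disjoint -/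
  disj : ∀ c d : Letter A, c ≠ d →
    Disjoint (Ioo (endLo c) (endHi c) ×ˢ ({comp c} : Set Bool))
      (Ioo (endLo d) (endHi d) ×ˢ ({comp d} : Set Bool))
  Sig_disj : ∀ c : Letter A,
    Disjoint Sig (Ioo (endLo c) (endHi c) ×ˢ ({comp c} : Set Bool))
  /-- the intervals `I_c` partition `Î` minus the division points -/
  cover : Ioo lo hi ×ˢ (univ : Set Bool) =
    (⋃ c : Letter A, Ioo (endLo c) (endHi c) ×ˢ ({comp c} : Set Bool)) ∪ Sig
  /-- the first involution `σ₁` (as a total map; only its values on `Î ∖ Σ` matter) -/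
  s1 : ℝ × Bool → ℝ × Bool
  s1_invol : ∀ z ∈ (Ioo lo hi ×ˢ (univ : Set Bool)) \ Sig, s1 (s1 z) = z
  /-- on each `I_c`, `σ₁` is either a translation or a symmetry -/
  s1_iso : ∀ c : Letter A,
    (∃ α : ℝ, ∀ z ∈ Ioo (endLo c) (endHi c) ×ˢ ({comp c} : Set Bool),
        s1 z = (z.1 + α, comp (Letter.inv c))) ∨
    (∃ α : ℝ, ∀ z ∈ Ioo (endLo c) (endHi c) ×ˢ ({comp c} : Set Bool),
        s1 z = (-z.1 + α, comp (Letter.inv c)))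
  /-- `σ₁` maps `I_c` onto `I_{c⁻¹}` -/
  s1_image : ∀ c : Letter A,
    s1 '' (Ioo (endLo c) (endHi c) ×ˢ ({comp c} : Set Bool)) =
      Ioo (endLo (Letter.inv c)) (endHi (Letter.inv c)) ×ˢ
        ({comp (Letter.inv c)} : Set Bool)

namespace LinearInvolution

variable {A : Type*} [Fintype A] (L : LinearInvolution A)

/-- The domain `Î = I × {0,1}`. -/
def Ihat : Set (ℝ × Bool) := Ioo L.lo L.hi ×ˢ (univ : Set Bool)

/-- The interval `I_c` associated with the letter `c ∈ A ∪ A⁻¹`. -/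
def Ia (c : Letter A) : Set (ℝ × Bool) :=
  Ioo (L.endLo c) (L.endHi c) ×ˢ ({L.comp c} : Set Bool)

/-- The linear involution `T = σ₂ ∘ σ₁`. -/
def T (z : ℝ × Bool) : ℝ × Bool := s2 (L.s1 z)

/-- `O = ⋃_{n ≥ 0} T⁻ⁿ(Σ)`, the negative orbit of the singular points. -/
def O : Set (ℝ × Bool) := ⋃ n : ℕ, (L.T)^[n] ⁻¹' L.Sig

/-- `Ô = O ∪ σ₂(O)`. -/
def Ohat : Set (ℝ × Bool) := L.O ∪ s2 '' L.O

/-- `T` has a connection if some singularity `x` of `T⁻¹` reaches a singularity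
`y` of `T` in `n ≥ 0` steps. -/
def HasConnection : Prop := ∃ x ∈ s2 '' L.Sig, ∃ n : ℕ, (L.T)^[n] x ∈ L.Sig

/-- `T` is nonorientable if some `I_c` and `I_{c⁻¹}` lie in the same component. -/
def Nonorientable : Prop := ∃ c : Letter A, L.comp c = L.comp (Letter.inv c)

/-- `T` is orientable if it is not nonorientable. -/
def Orientable : Prop := ¬ L.Nonorientable

/-- `u` occurs in the natural coding of the orbit of `z` at position `m`. -/
def IsCodingFrom (z : ℝ × Bool) (m : ℕ) (u : List (Letter A)) : Prop :=
  ∀ i : Fin u.length, (L.T)^[m + i.1] z ∈ L.Ia (u.get i)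

/-- The natural coding `L(T)`: the set of factors of the infinite natural
codings `Σ_T(z)` for `z ∈ Î ∖ Ô`. -/
def lang : Set (List (Letter A)) :=
  {u | ∃ z ∈ L.Ihat \ L.Ohat, ∃ m : ℕ, L.IsCodingFrom z m u}

/-- The interval `I_w = I_{a₀} ∩ T⁻¹(I_{a₁}) ∩ ⋯ ∩ T^{-m+1}(I_{a_{m-1}})`
associated with a word `w = a₀a₁⋯a_{m-1}`; by convention `I_ε = Î`. -/
def Iw (u : List (Letter A)) : Set (ℝ × Bool) :=
  L.Ihat ∩ ⋂ i : Fin u.length, (L.T)^[i.1] ⁻¹' L.Ia (u.get i)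

/-- The return time `ρ_X(x) = inf {n ≥ 1 ∣ Tⁿ(x) ∈ X}`, with value `∞` if the
orbit of `x` never returns to `X`. -/
noncomputable def retTime (X : Set (ℝ × Bool)) (x : ℝ × Bool) : ℕ∞ :=
  sInf {n : ℕ∞ | ∃ m : ℕ, n = (m : ℕ∞) ∧ 1 ≤ m ∧ (L.T)^[m] x ∈ X}

/-- A word is even if it has an even number of odd letters (a letter `a` is odd
when `I_a` and `I_{a⁻¹}` lie in the same component). -/
def EvenWord (u : List (Letter A)) : Prop :=
  Even (u.countP fun c => L.comp (c.1, true) == L.comp (c.1, false))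

/-- The morphism `F_A → ℤ/2ℤ` sending each odd letter to `1` and each even
letter to `0`. -/
noncomputable def evenHom : FreeGroup A →* Multiplicative (ZMod 2) :=
  FreeGroup.lift fun a =>
    Multiplicative.ofAdd (if L.comp (a, true) = L.comp (a, false) then (1 : ZMod 2) else 0)

/-- The even group: the subgroup of `F_A` formed by the even elements. -/
noncomputable def evenGroup : Subgroup (FreeGroup A) := (L.evenHom).ker

/-- The admissibility condition at an endpoint `x` of an interval `J`:
either `x = Tⁿ(z)` for a singularity `z` of `T⁻¹` with `T^k(z) ∉ J` for
`0 ≤ k ≤ n`, or `Tⁿ(x) = z` for a singularity `z` of `T` with `T^k(x) ∉ J`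
for `0 ≤ k ≤ n`. -/
def AdmissibleEndpoint (J : Set (ℝ × Bool)) (x : ℝ × Bool) : Prop :=
  (∃ z ∈ s2 '' L.Sig, ∃ n : ℕ, (L.T)^[n] z = x ∧ ∀ k ≤ n, (L.T)^[k] z ∉ J) ∨
  (∃ z ∈ L.Sig, ∃ n : ℕ, (L.T)^[n] x = z ∧ ∀ k ≤ n, (L.T)^[k] x ∉ J)

/-- The open interval `]u,v[ × {δ}` is admissible with respect to `T`. -/
def AdmissibleInterval (u v : ℝ) (δ : Bool) : Prop :=
  u < v ∧ L.AdmissibleEndpoint (Ioo u v ×ˢ ({δ} : Set Bool)) (u, δ) ∧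
    L.AdmissibleEndpoint (Ioo u v ×ˢ ({δ} : Set Bool)) (v, δ)

end LinearInvolution

/-- A set of words is factorial if it contains the factors of its elements. -/
def FactorialSet {α : Type*} (S : Set (List α)) : Prop :=
  ∀ u ∈ S, ∀ v : List α, v <:+: u → v ∈ S

/-- A word over `A ∪ A⁻¹` is reduced if it has no factor `c c⁻¹`. -/
def Reduced {A : Type*} (u : List (Letter A)) : Prop :=
  u.Chain' fun c d => d ≠ Letter.inv c

/-- A laminary set on `A`: a symmetric factorial set of reduced words on
`A ∪ A⁻¹`. -/
def Laminary {A : Type*} (S : Set (List (Letter A))) : Prop :=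
  FactorialSet S ∧ (∀ u ∈ S, wordInv u ∈ S) ∧ ∀ u ∈ S, Reduced u

/-- A laminary set is orientable if it splits as `S₊ ∪ S₋` with `S₊, S₋`
factorial, `S₊ ∩ S₋ = {ε}`, and `x ∈ S₋ ↔ x⁻¹ ∈ S₊`. -/
def OrientableSet {A : Type*} (S : Set (List (Letter A))) : Prop :=
  ∃ Sp Sm : Set (List (Letter A)), FactorialSet Sp ∧ FactorialSet Sm ∧
    S = Sp ∪ Sm ∧ Sp ∩ Sm = {([] : List (Letter A))} ∧
    ∀ x ∈ S, (x ∈ Sm ↔ wordInv x ∈ Sp)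

/-- A set of words is uniformly recurrent if it is right extendable and every
`u ∈ S` occurs in every long enough word of `S`. -/
def UniformlyRecurrent {α : Type*} (S : Set (List α)) : Prop :=
  (∀ u ∈ S, ∃ c : α, u ++ [c] ∈ S) ∧
  ∀ u ∈ S, ∃ n : ℕ, 1 ≤ n ∧ ∀ w ∈ S, w.length = n → u <:+: w

/-- A set of words over `A ∪ A⁻¹` is uniformly semi-recurrent if it is right
extendable and for every `u ∈ S`, every long enough word of `S` contains `u` or
`u⁻¹` as a factor. -/
def UniformlySemiRecurrent {A : Type*} (S : Set (List (Letter A))) : Prop :=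
  (∀ u ∈ S, ∃ c : Letter A, u ++ [c] ∈ S) ∧
  ∀ u ∈ S, ∃ n : ℕ, 1 ≤ n ∧ ∀ w ∈ S, w.length = n → (u <:+: w ∨ wordInv u <:+: w)

/-- A laminary set is semi-recurrent if for all `u, w ∈ S` there is `v ∈ S`
with `uvw ∈ S` or `uvw⁻¹ ∈ S`. -/
def SemiRecurrent {A : Type*} (S : Set (List (Letter A))) : Prop :=
  ∀ u ∈ S, ∀ w ∈ S, ∃ v ∈ S, u ++ v ++ w ∈ S ∨ u ++ v ++ wordInv w ∈ S

/-- A complete return word to `X ⊆ S`: a word of `S` with a proper prefix in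
`X` and a proper suffix in `X`. -/
def CompleteReturnWord {α : Type*} (S X : Set (List α)) (u : List α) : Prop :=
  u ∈ S ∧ (∃ p ∈ X, p <+: u ∧ p ≠ u) ∧ (∃ s ∈ X, s <:+ u ∧ s ≠ u)

/-- A complete first return word to `X`: a complete return word to `X` with no
internal factor in `X`. -/
def CompleteFirstReturnWord {α : Type*} (S X : Set (List α)) (u : List α) : Prop :=
  CompleteReturnWord S X u ∧
    ¬ ∃ p v s : List α, u = p ++ v ++ s ∧ v ∈ X ∧ p ≠ [] ∧ s ≠ []

/-- `CR S w`: the set of complete first return words to `{w, w⁻¹}` in `S`. -/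
def CR {A : Type*} (S : Set (List (Letter A))) (w : List (Letter A)) :
    Set (List (Letter A)) :=
  {u | CompleteFirstReturnWord S {w, wordInv w} u}

open Classical in
/-- The operation `N` on complete return words to `{w, w⁻¹}`: erase the prefix
`w` if present, and erase the suffix `w⁻¹` if present. -/
noncomputable def NN {A : Type*} (w u : List (Letter A)) : List (Letter A) :=
  let u' := if w <+: u then u.drop w.length else u
  if wordInv w <:+ u' then u'.take (u'.length - w.length) else u'

/-- `MR S w`: the set of mixed first return words to `w` in `S`. -/
noncomputable def MR {A : Type*} (S : Set (List (Letter A))) (w : List (Letter A)) :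
    Set (List (Letter A)) :=
  NN w '' CR S w

/-- `RightReturn S w`: the set of first right return words to `w` in `S`,
i.e. the words `u` such that `wu` is a complete first return word to `{w}`. -/
def RightReturn {α : Type*} (S : Set (List α)) (w : List α) : Set (List α) :=
  {u | CompleteFirstReturnWord S {w} (w ++ u)}

/-- `X` is a basis (free generating set) of the subgroup `H`: the canonical map
`FreeGroup X → G` is injective with range `H`. -/
def IsBasisOf {G : Type*} [Group G] (X : Set G) (H : Subgroup G) : Prop :=
  Function.Injective (FreeGroup.lift (fun x : X => (x : G))) ∧
    (FreeGroup.lift (fun x : X => (x : G)) : FreeGroup X →* G).range = H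

/-- `Y` is a symmetric basis of `H` if `Y = X ∪ X⁻¹` for some basis `X` of `H`. -/
def IsSymmetricBasisOf {G : Type*} [Group G] (Y : Set G) (H : Subgroup G) : Prop :=
  ∃ X : Set G, IsBasisOf X H ∧ Y = X ∪ X⁻¹

/-- The prime words in `S` with respect to a subgroup `G` of `F_A`: the
nonempty words of `G ∩ S` without a proper nonempty prefix in `G ∩ S`. -/
def PrimeWords {A : Type*} (S : Set (List (Letter A))) (G : Subgroup (FreeGroup A)) :
    Set (List (Letter A)) :=
  {u | u ∈ S ∧ u ≠ [] ∧ FreeGroup.mk u ∈ G ∧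
    ∀ p : List (Letter A), p <+: u → p ≠ [] → p ≠ u → ¬(p ∈ S ∧ FreeGroup.mk p ∈ G)}

universe u

/-- Free groups are residually finite: a nontrivial element acts nontrivially on a
finite set, namely a ball for the word norm with partial translations extended to
permutations. -/
theorem exists_finite_quotient_ne_one {A : Type u} [Finite A] (g : FreeGroup A) (hg : g ≠ 1) :
    ∃ (Q : Type u) (_ : Group Q) (_ : Finite Q) (f : FreeGroup A →* Q), f g ≠ 1 := by
  classical
  let n := g.norm
  let X := {x : FreeGroup A // x.norm ≤ n}
  have hfin : Finite X := by
    have : ({l : List (A × Bool) | l.length ≤ n}).Finite := List.finite_length_le _ _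
    have := this.to_subtype
    refine Finite.of_injective
      (fun x : X => (⟨x.1.toWord, x.2⟩ : {l : List (A × Bool) | l.length ≤ n})) ?_
    intro x y h
    exact Subtype.ext (FreeGroup.toWord_injective (congrArg Subtype.val h))
  have := Fintype.ofFinite X
  let e (a : A) : {x : X // (FreeGroup.of a * x.1).norm ≤ n} ≃
      {x : X // ((FreeGroup.of a)⁻¹ * x.1).norm ≤ n} :=
    { toFun := fun x => ⟨⟨FreeGroup.of a * x.1.1, x.2⟩, by simpa using x.1.2⟩
      invFun := fun x => ⟨⟨(FreeGroup.of a)⁻¹ * x.1.1, x.2⟩, by simpa using x.1.2⟩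
      left_inv := fun x => by simp
      right_inv := fun x => by simp }
  let f : FreeGroup A →* Equiv.Perm X := FreeGroup.lift fun a => (e a).extendSubtype
  have key : ∀ (l : List (A × Bool)) (hl : l.length ≤ n),
      f (FreeGroup.mk l) ⟨1, by simp⟩ = ⟨FreeGroup.mk l, FreeGroup.norm_mk_le.trans hl⟩ := by
    intro l
    induction l with
    | nil =>
      intro hl
      apply Subtype.ext
      change ((f 1 : Equiv.Perm X) ⟨1, _⟩ : X).1 = 1
      rw [map_one]
      rfl
    | cons c l ih =>
      intro hl
      have hl' : l.length ≤ n := by simp at hl; omega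
      have hm : FreeGroup.mk (c :: l) = FreeGroup.mk [c] * FreeGroup.mk l := by
        simp [FreeGroup.mul_mk]
      have hn : (FreeGroup.mk (c :: l)).norm ≤ n := FreeGroup.norm_mk_le.trans hl
      have hn' : (FreeGroup.mk l).norm ≤ n := FreeGroup.norm_mk_le.trans hl'
      have : f (FreeGroup.mk (c :: l)) ⟨1, by simp⟩ =
          f (FreeGroup.mk [c]) ⟨FreeGroup.mk l, hn'⟩ := by
        rw [hm, map_mul, Equiv.Perm.mul_apply, ih hl']
      rw [this]
      obtain ⟨a, b⟩ := c
      cases b with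
      | true =>
        have h1 : FreeGroup.mk [(a, true)] = FreeGroup.of a := rfl
        rw [h1] at hm ⊢
        have hp : (FreeGroup.of a * FreeGroup.mk l).norm ≤ n := hm ▸ hn
        simp only [f, FreeGroup.lift_apply_of]
        rw [Equiv.extendSubtype_apply_of_mem (e a) ⟨FreeGroup.mk l, hn'⟩ hp]
        exact Subtype.ext hm.symm
      | false =>
        have h1 : FreeGroup.mk [(a, false)] = (FreeGroup.of a)⁻¹ := rfl
        rw [h1] at hm ⊢
        have hp : (FreeGroup.of a * FreeGroup.mk ((a, false) :: l)).norm ≤ n := by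
          rw [hm]; simpa using hn'
        simp only [f, map_inv, FreeGroup.lift_apply_of]
        rw [Equiv.Perm.inv_eq_iff_eq,
          Equiv.extendSubtype_apply_of_mem (e a) ⟨FreeGroup.mk ((a, false) :: l), hn⟩ hp]
        apply Subtype.ext
        change FreeGroup.mk l = FreeGroup.of a * FreeGroup.mk ((a, false) :: l)
        rw [hm]; simp
  refine ⟨Equiv.Perm X, inferInstance, inferInstance, f, fun h => hg ?_⟩
  have h2 := key g.toWord le_rfl
  simp only [FreeGroup.mk_toWord] at h2
  rw [h] at h2
  exact (congrArg Subtype.val h2).symm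

/-- Finitely generated free groups are Hopfian. -/
theorem freeGroup_injective_of_surjective {A : Type*} [Finite A]
    (φ : FreeGroup A →* FreeGroup A) (hφ : Function.Surjective φ) : Function.Injective φ := by
  rw [injective_iff_map_eq_one]
  intro g hg
  by_contra hne
  obtain ⟨Q, _, _, f, hf⟩ := exists_finite_quotient_ne_one g hne
  have : Finite (FreeGroup A →* Q) :=
    Finite.of_equiv (A → Q) FreeGroup.lift
  have hinj : Function.Injective (fun ψ : FreeGroup A →* Q => ψ.comp φ) := by
    intro ψ₁ ψ₂ h
    ext1 a
    obtain ⟨x, hx⟩ := hφ (FreeGroup.of a)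
    rw [← hx]
    exact DFunLike.congr_fun h x
  obtain ⟨ψ, hψ⟩ := Finite.surjective_of_injective hinj f
  apply hf
  rw [← hψ]
  simp [hg]

/-- A generating set of a free group of rank `k` with at most `k` elements is a basis. -/
theorem isBasisOf_top_of_card_le {A : Type*} [Fintype A] (X : Set (FreeGroup A))
    (hX : X.Finite) (hcard : X.ncard ≤ Fintype.card A) (hgen : Subgroup.closure X = ⊤) :
    IsBasisOf X (⊤ : Subgroup (FreeGroup A)) := by
  classical
  have hXf := hX.fintype
  have hrange : (FreeGroup.lift (fun x : X => (x : FreeGroup A))).range = ⊤ := by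
    rw [FreeGroup.range_lift_eq_closure]; simpa using hgen
  refine ⟨?_, hrange⟩
  rw [← Nat.card_coe_set_eq, Nat.card_eq_fintype_card] at hcard
  obtain ⟨i⟩ := Function.Embedding.nonempty_of_card_le hcard
  rcases isEmpty_or_nonempty X with hE | hN
  · intro x y _
    exact Subsingleton.elim _ _
  let s : A → X := Function.invFun i
  have hs : Function.LeftInverse s i := Function.leftInverse_invFun i.injective
  let φ : FreeGroup A →* FreeGroup A :=
    (FreeGroup.lift (fun x : X => (x : FreeGroup A))).comp (FreeGroup.map s)
  have hsi : ∀ x, FreeGroup.map s (FreeGroup.map i x) = x := by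
    intro x
    rw [FreeGroup.map.comp]
    convert FreeGroup.map.id x
    exact hs.comp_eq_id
  have hφ : Function.Surjective φ := by
    intro y
    obtain ⟨x, hx⟩ : y ∈ (FreeGroup.lift (fun x : X => (x : FreeGroup A))).range := by
      rw [hrange]; trivial
    exact ⟨FreeGroup.map i x, by simp [φ, hsi, hx]⟩
  have hinj := freeGroup_injective_of_surjective φ hφ
  intro x y hxy
  have h3 : FreeGroup.map i x = FreeGroup.map i y := by
    apply hinj
    simp [φ, hsi, hxy]
  rw [← hsi x, ← hsi y, h3]

/-- A finite set with a fixed-point-free involution is the union of a half and its image. -/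
theorem exists_half {α : Type*} (C : Set α) (hC : C.Finite) (ι : α → α)
    (hinv : ∀ x, ι (ι x) = x) (hmap : ∀ x ∈ C, ι x ∈ C) (hne : ∀ x ∈ C, ι x ≠ x) :
    ∃ D ⊆ C, C = D ∪ ι '' D ∧ 2 * D.ncard = C.ncard := by
  classical
  let r : α → α → Prop := WellOrderingRel
  have htri : ∀ a b : α, r a b ∨ a = b ∨ r b a := trichotomous_of r
  let D := {x ∈ C | r x (ι x)}
  have hun : C = D ∪ ι '' D := by
    ext x
    constructor
    · intro hx
      rcases htri x (ι x) with h | h | h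
      · exact Or.inl ⟨hx, h⟩
      · exact absurd h.symm (hne x hx)
      · exact Or.inr ⟨ι x, ⟨hmap x hx, by rwa [hinv]⟩, hinv x⟩
    · rintro (h | ⟨y, h, rfl⟩)
      · exact h.1
      · exact hmap _ h.1
  have hsub : D ⊆ C := fun x hx => hx.1
  have hD : D.Finite := hC.subset hsub
  refine ⟨D, hsub, hun, ?_⟩
  have hdisj : Disjoint D (ι '' D) := by
    rw [Set.disjoint_left]
    rintro x hx ⟨y, hy, rfl⟩
    have h1 := hx.2
    rw [hinv] at h1
    exact asymm_of r h1 hy.2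
  rw [hun, Set.ncard_union_eq hdisj hD (hD.image _),
    Set.ncard_image_of_injective _ (Function.LeftInverse.injective hinv)]
  have : D ∪ ι '' D = C := hun.symm
  omega

section Words

variable {A : Type*}

theorem Letter.inv_inv (c : Letter A) : Letter.inv (Letter.inv c) = c := by
  simp [Letter.inv]

theorem wordInv_append (u v : List (Letter A)) :
    wordInv (u ++ v) = wordInv v ++ wordInv u := by
  simp [wordInv]

theorem wordInv_cons (c : Letter A) (u : List (Letter A)) :
    wordInv (c :: u) = wordInv u ++ [Letter.inv c] := by
  simp [wordInv]

theorem wordInv_singleton (c : Letter A) : wordInv [c] = [Letter.inv c] := by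
  simp [wordInv]

theorem wordInv_wordInv (u : List (Letter A)) : wordInv (wordInv u) = u := by
  induction u with
  | nil => rfl
  | cons c u ih => rw [wordInv_cons, wordInv_append, ih, wordInv_singleton, Letter.inv_inv]; rfl

theorem length_wordInv (u : List (Letter A)) : (wordInv u).length = u.length := by
  simp [wordInv]

theorem wordInv_ne_nil {u : List (Letter A)} (hu : u ≠ []) : wordInv u ≠ [] := by
  intro h
  apply hu
  have := length_wordInv u
  rw [h] at this
  exact List.length_eq_zero_iff.mp this.symm

theorem mk_wordInv (u : List (Letter A)) :
    FreeGroup.mk (wordInv u) = (FreeGroup.mk u)⁻¹ :=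
  FreeGroup.inv_mk.symm

theorem Reduced.isReduced {u : List (Letter A)} (hu : Reduced u) : FreeGroup.IsReduced u := by
  refine List.IsChain.imp ?_ hu
  rintro ⟨a, b⟩ ⟨c, d⟩ h h1
  simp only at h1
  subst h1
  by_contra hbd
  apply h
  cases b <;> cases d <;> simp_all [Letter.inv]

theorem Reduced.of_isInfix {u v : List (Letter A)} (hu : Reduced u) (h : v <:+: u) : Reduced v :=
  List.IsChain.infix hu h

/-- A nonempty reduced word differs from its inverse. -/
theorem Reduced.wordInv_ne {u : List (Letter A)} (hu : Reduced u) (hne : u ≠ []) :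
    wordInv u ≠ u := by
  intro h
  have h1 : FreeGroup.mk u = 1 := by
    have h2 : (FreeGroup.mk u)⁻¹ = FreeGroup.mk u := by rw [← mk_wordInv, h]
    have h3 : (FreeGroup.mk u) ^ 2 = 1 := by
      rw [pow_two]; nth_rewrite 1 [← h2]; exact inv_mul_cancel _
    exact (pow_eq_one_iff_left two_ne_zero).mp h3
  classical
  have h4 := congrArg FreeGroup.toWord h1
  rw [FreeGroup.toWord_mk, hu.isReduced.reduce_eq, FreeGroup.toWord_one] at h4
  exact hne h4

end Words

section WordSums

variable {A : Type*} [Fintype A]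

/-- The finite set of words of length `m`. -/
noncomputable def wordsOfLength (A : Type*) [Fintype A] (m : ℕ) : Finset (List (Letter A)) :=
  (List.finite_length_eq (Letter A) m).toFinset

theorem mem_wordsOfLength {m : ℕ} {u : List (Letter A)} :
    u ∈ wordsOfLength A m ↔ u.length = m := by
  simp [wordsOfLength]

theorem sum_wordsOfLength_cons (F : List (Letter A) → ℝ) (m : ℕ) :
    ∑ x ∈ wordsOfLength A (m + 1), F x =
      ∑ x ∈ wordsOfLength A m, ∑ c : Letter A, F (c :: x) := by
  rw [← Finset.sum_product']
  symm
  refine Finset.sum_bij (fun p _ => p.2 :: p.1) ?_ ?_ ?_ ?_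
  · rintro ⟨x, c⟩ h
    simp [mem_wordsOfLength] at h ⊢
    exact h
  · rintro ⟨x, c⟩ _ ⟨y, d⟩ _ h
    simp at h
    simp [h]
  · intro y hy
    rw [mem_wordsOfLength] at hy
    obtain ⟨c, x, rfl⟩ := List.exists_cons_of_length_eq_add_one hy
    exact ⟨(x, c), by simpa [mem_wordsOfLength] using hy, rfl⟩
  · intro _ _
    rfl

theorem sum_wordsOfLength_concat (F : List (Letter A) → ℝ) (m : ℕ) :
    ∑ x ∈ wordsOfLength A (m + 1), F x =
      ∑ c : Letter A, ∑ x ∈ wordsOfLength A m, F (x ++ [c]) := by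
  rw [Finset.sum_comm, ← Finset.sum_product']
  symm
  refine Finset.sum_bij (fun p _ => p.1 ++ [p.2]) ?_ ?_ ?_ ?_
  · rintro ⟨x, c⟩ h
    simp [mem_wordsOfLength] at h ⊢
    exact h
  · rintro ⟨x, c⟩ _ ⟨y, d⟩ _ h
    simpa using List.append_inj' h rfl
  · intro y hy
    rw [mem_wordsOfLength] at hy
    have hne : y ≠ [] := by rintro rfl; simp at hy
    refine ⟨(y.dropLast, y.getLast hne), ?_, List.dropLast_append_getLast hne⟩
    simp [mem_wordsOfLength, hy]
  · intro _ _
    rfl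

/-- The total weight of a suffix code, for a nonnegative weight that is additive
with respect to left extensions. -/
theorem sum_suffixCode_le (f : List (Letter A) → ℝ) (hf : ∀ u, 0 ≤ f u)
    (hadd : ∀ u, u ≠ [] → ∑ c : Letter A, f (c :: u) = f u)
    (Y : Finset (List (Letter A))) (hne : ∀ y ∈ Y, y ≠ [])
    (hcode : ∀ y ∈ Y, ∀ y' ∈ Y, y <:+ y' → y = y') :
    ∑ y ∈ Y, f y ≤ ∑ c : Letter A, f [c] := by
  classical
  have hext : ∀ y : List (Letter A), y ≠ [] → ∀ j : ℕ,
      ∑ x ∈ wordsOfLength A j, f (x ++ y) = f y := by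
    intro y hy j
    induction j with
    | zero =>
      have : wordsOfLength A 0 = {[]} := by
        ext u; simp [mem_wordsOfLength]
      simp [this]
    | succ j ih =>
      rw [sum_wordsOfLength_cons (fun x => f (x ++ y)), ← ih]
      refine Finset.sum_congr rfl fun x _ => ?_
      simpa using hadd (x ++ y) (by simp [hy])
  have htot : ∀ j : ℕ, ∑ x ∈ wordsOfLength A (j + 1), f x = ∑ c : Letter A, f [c] := by
    intro j
    rw [sum_wordsOfLength_concat]
    exact Finset.sum_congr rfl fun c _ => hext [c] (by simp) j
  let N := Y.sup List.length
  have hN : ∀ y ∈ Y, y.length ≤ N := fun y hy => Finset.le_sup (f := List.length) hy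
  rw [← htot N]
  calc ∑ y ∈ Y, f y
      = ∑ y ∈ Y, ∑ x ∈ wordsOfLength A (N + 1 - y.length), f (x ++ y) :=
        Finset.sum_congr rfl fun y hy => (hext y (hne y hy) _).symm
    _ = ∑ p ∈ Y.sigma (fun y => wordsOfLength A (N + 1 - y.length)), f (p.2 ++ p.1) := by
        rw [Finset.sum_sigma]
    _ = ∑ z ∈ (Y.sigma (fun y => wordsOfLength A (N + 1 - y.length))).image
          (fun p => p.2 ++ p.1), f z := by
        rw [Finset.sum_image]
        rintro ⟨y, x⟩ h ⟨y', x'⟩ h' heq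
        simp only [Finset.coe_sigma, Set.mem_sigma_iff, Finset.mem_coe] at h h'
        simp only at heq
        have hyy : y = y' := by
          rcases List.suffix_or_suffix_of_suffix (List.suffix_append x y)
            (heq ▸ List.suffix_append x' y') with h1 | h1
          · exact hcode _ h.1 _ h'.1 h1
          · exact (hcode _ h'.1 _ h.1 h1).symm
        subst hyy
        simpa using heq
    _ ≤ ∑ x ∈ wordsOfLength A (N + 1), f x := by
        refine Finset.sum_le_sum_of_subset_of_nonneg ?_ fun x _ _ => hf x
        intro z hz
        simp only [Finset.mem_image, Finset.mem_sigma, mem_wordsOfLength] at hz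
        obtain ⟨⟨y, x⟩, ⟨hy, hx⟩, rfl⟩ := hz
        simp only at hx hy ⊢
        have := hN y hy
        rw [mem_wordsOfLength, List.length_append, hx]
        omega

end WordSums

/-- Counting pairs by their first component. -/
theorem ncard_pairs {A : Type*} [Fintype A] (T : Letter A → Set (Letter A)) :
    {p : Letter A × Letter A | p.2 ∈ T p.1}.ncard = ∑ a, (T a).ncard := by
  classical
  have h1 : {p : Letter A × Letter A | p.2 ∈ T p.1} =
      ↑((Finset.univ : Finset (Letter A)).biUnion fun a => (T a).toFinset.image fun b => (a, b)) := by
    ext ⟨a, b⟩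
    simp
  rw [h1, Set.ncard_coe_finset, Finset.card_biUnion]
  · refine Finset.sum_congr rfl fun a _ => ?_
    rw [Finset.card_image_of_injective _ (fun x y h => (Prod.mk.inj h).2),
      Set.ncard_eq_toFinset_card']
  · intro a _ a' _ hne
    rw [Function.onFun, Finset.disjoint_left]
    simp only [Finset.mem_image]
    rintro _ ⟨b, _, rfl⟩ ⟨b', _, h⟩
    exact hne (Prod.mk.inj h).1.symm

/-- The combinatorial properties of the natural coding of a linear involution without
connection from which the structure of return words follows: a symmetric factorial set
of reduced words all of whose extension graphs are trees (up to inversion for the empty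
word), which carries a bi-invariant weight. -/
structure IsTreeSet {A : Type*} [Fintype A] (S : Set (List (Letter A))) : Prop where
  factorial : FactorialSet S
  inv_mem : ∀ u ∈ S, wordInv u ∈ S
  reduced : ∀ u ∈ S, Reduced u
  letter_mem : ∀ c, [c] ∈ S
  connected_nil : ∀ P : Letter A → Prop, (∀ a b, [a, b] ∈ S → (P a ↔ P (Letter.inv b))) →
    ∀ a a', P a → P a'
  connected : ∀ v, v ≠ [] → ∀ P Q : Letter A → Prop,
    (∀ a b, a :: (v ++ [b]) ∈ S → (P a ↔ Q b)) →
    ∀ b b', v ++ [b] ∈ S → v ++ [b'] ∈ S → Q b → Q b'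
  card_nil : {p : Letter A × Letter A | [p.1, p.2] ∈ S}.ncard + 2 = 4 * Fintype.card A
  card : ∀ v ∈ S, v ≠ [] →
    {p : Letter A × Letter A | p.1 :: (v ++ [p.2]) ∈ S}.ncard + 1 =
      {a | a :: v ∈ S}.ncard + {b | v ++ [b] ∈ S}.ncard
  weight : ∃ μ : List (Letter A) → ℝ, (∀ u, 0 ≤ μ u) ∧ (∀ u, u ∈ S ↔ 0 < μ u) ∧
    (∀ u, ∑ c : Letter A, μ (c :: u) = μ u) ∧ (∀ u, ∑ c : Letter A, μ (u ++ [c]) = μ u)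

namespace IsTreeSet

variable {A : Type*} [Fintype A] {S : Set (List (Letter A))}

theorem mem_of_isInfix (hS : IsTreeSet S) {u v : List (Letter A)} (hu : u ∈ S) (h : v <:+: u) :
    v ∈ S :=
  hS.factorial u hu v h

theorem exists_concat_mem (hS : IsTreeSet S) {u : List (Letter A)} (hu : u ∈ S) :
    ∃ c, u ++ [c] ∈ S := by
  obtain ⟨μ, h0, hpos, -, hr⟩ := hS.weight
  by_contra! hcon
  have h1 := (hpos u).mp hu
  rw [← hr u, Finset.sum_eq_zero] at h1
  · exact lt_irrefl _ h1
  · intro c _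
    exact le_antisymm (not_lt.mp fun h => hcon c ((hpos _).mpr h)) (h0 _)

theorem exists_cons_mem (hS : IsTreeSet S) {u : List (Letter A)} (hu : u ∈ S) :
    ∃ c, c :: u ∈ S := by
  obtain ⟨c, hc⟩ := hS.exists_concat_mem (hS.inv_mem u hu)
  refine ⟨Letter.inv c, ?_⟩
  have := hS.inv_mem _ hc
  rwa [wordInv_append, wordInv_wordInv, wordInv_singleton] at this

theorem exists_append_mem (hS : IsTreeSet S) {u : List (Letter A)} (hu : u ∈ S) (j : ℕ) :
    ∃ v, u ++ v ∈ S ∧ v.length = j := by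
  induction j with
  | zero => exact ⟨[], by simpa using hu, rfl⟩
  | succ j ih =>
    obtain ⟨v, hv, hl⟩ := ih
    obtain ⟨c, hc⟩ := hS.exists_concat_mem hv
    exact ⟨v ++ [c], by simpa using hc, by simp [hl]⟩

open Classical in
/-- The number of right extensions of a word of `S`, minus one. -/
noncomputable def excess (S : Set (List (Letter A))) (u : List (Letter A)) : ℝ :=
  if u ∈ S then ({b | u ++ [b] ∈ S}.ncard : ℝ) - 1 else 0

theorem one_le_ncard (hS : IsTreeSet S) {u : List (Letter A)} (hu : u ∈ S) :
    1 ≤ {b | u ++ [b] ∈ S}.ncard := by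
  rw [Nat.one_le_iff_ne_zero, ← Nat.pos_iff_ne_zero, Set.ncard_pos]
  exact hS.exists_concat_mem hu

theorem excess_nonneg (hS : IsTreeSet S) (u : List (Letter A)) : 0 ≤ excess S u := by
  unfold excess
  split_ifs with h
  · have : (1 : ℝ) ≤ ({b | u ++ [b] ∈ S}.ncard : ℝ) := by exact_mod_cast hS.one_le_ncard h
    linarith
  · exact le_rfl

theorem sum_excess_cons (hS : IsTreeSet S) (u : List (Letter A)) (hu : u ≠ []) :
    ∑ c : Letter A, excess S (c :: u) = excess S u := by
  classical
  by_cases hmem : u ∈ S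
  · have h1 := ncard_pairs (fun a => {b | a :: (u ++ [b]) ∈ S})
    have h2 := hS.card u hmem hu
    simp only [Set.mem_ofPred_eq] at h1
    rw [h1] at h2
    have h3 : ∀ c : Letter A, excess S (c :: u) =
        ({b | c :: (u ++ [b]) ∈ S}.ncard : ℝ) - if c :: u ∈ S then 1 else 0 := by
      intro c
      unfold excess
      split_ifs with h
      · rfl
      · have : {b | c :: (u ++ [b]) ∈ S} = ∅ := by
          rw [Set.eq_empty_iff_forall_notMem]
          intro b hb
          exact h (hS.mem_of_isInfix hb ⟨[], [b], by simp⟩)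
        simp [this]
    have h4 : ∑ c : Letter A, (if c :: u ∈ S then (1 : ℝ) else 0) =
        ({a | a :: u ∈ S}.ncard : ℝ) := by
      rw [Finset.sum_boole, Set.ncard_eq_toFinset_card']
      congr 2
      ext; simp
    simp_rw [h3]
    rw [Finset.sum_sub_distrib, h4, excess, if_pos hmem]
    have h5 := congrArg (Nat.cast (R := ℝ)) h2
    push_cast at h5
    linarith
  · rw [excess, if_neg hmem]
    refine Finset.sum_eq_zero fun c _ => ?_
    rw [excess, if_neg]
    exact fun h => hmem (hS.mem_of_isInfix h ⟨[c], [], by simp⟩)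

theorem sum_excess_letter (hS : IsTreeSet S) :
    ∑ c : Letter A, excess S [c] = 2 * Fintype.card A - 2 := by
  have h1 := ncard_pairs (fun a => {b | [a, b] ∈ S})
  simp only [Set.mem_ofPred_eq] at h1
  have h2 := hS.card_nil
  rw [h1] at h2
  have h5 := congrArg (Nat.cast (R := ℝ)) h2
  push_cast at h5
  have h3 : ∀ c : Letter A, excess S [c] = ({b | [c, b] ∈ S}.ncard : ℝ) - 1 := by
    intro c
    rw [excess, if_pos (hS.letter_mem c)]
    rfl
  simp_rw [h3]
  rw [Finset.sum_sub_distrib]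
  simp only [Finset.sum_const, Finset.card_univ, Fintype.card_prod, Fintype.card_bool]
  simp only [nsmul_eq_mul]
  push_cast
  linarith

end IsTreeSet

section Returns

variable {A : Type*} {S : Set (List (Letter A))} {w : List (Letter A)}

theorem length_of_mem_pair {x : List (Letter A)} (hx : x ∈ ({w, wordInv w} : Set _)) :
    x.length = w.length := by
  rcases hx with rfl | rfl
  · rfl
  · exact length_wordInv w

theorem wordInv_mem_pair {x : List (Letter A)} (hx : x ∈ ({w, wordInv w} : Set _)) :
    wordInv x ∈ ({w, wordInv w} : Set _) := by
  rcases hx with rfl | rfl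
  · simp
  · simp [wordInv_wordInv]

/-- The words of `S` which start with `w` or `w⁻¹` and contain no other occurrence of
`w` or `w⁻¹`. -/
def Pending (S : Set (List (Letter A))) (w : List (Letter A)) : Set (List (Letter A)) :=
  {u | u ∈ S ∧ (∃ x ∈ ({w, wordInv w} : Set _), x <+: u) ∧
    ∀ s x t, u = s ++ x ++ t → x ∈ ({w, wordInv w} : Set _) → s = []}

theorem Pending.eq_of_suffix {u u' : List (Letter A)} (hu : u ∈ Pending S w)
    (hu' : u' ∈ Pending S w) (h : u <:+ u') : u = u' := by
  obtain ⟨s, rfl⟩ := h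
  obtain ⟨x, hx, t, rfl⟩ := hu.2.1
  rw [hu'.2.2 s x t (by simp) hx]
  rfl

theorem Pending.length_le {u : List (Letter A)} (hu : u ∈ Pending S w) :
    w.length ≤ u.length := by
  obtain ⟨x, hx, h⟩ := hu.2.1
  rw [← length_of_mem_pair hx]
  exact h.length_le

theorem Pending.ne_nil {u : List (Letter A)} (hne : w ≠ []) (hu : u ∈ Pending S w) : u ≠ [] := by
  rintro rfl
  have := Pending.length_le hu
  simp at this
  exact hne this

theorem CR.length_lt {u : List (Letter A)} (hu : u ∈ CR S w) : w.length < u.length := by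
  obtain ⟨⟨-, ⟨p, hp, hpu, hne⟩, -⟩, -⟩ := hu
  rw [← length_of_mem_pair hp]
  exact lt_of_le_of_ne hpu.length_le fun h => hne (hpu.eq_of_length h)

theorem CR.notMem_pending {u : List (Letter A)} (hu : u ∈ CR S w) : u ∉ Pending S w := by
  rintro ⟨-, -, h⟩
  obtain ⟨⟨-, -, ⟨x, hx, ⟨s, rfl⟩, hne⟩⟩, -⟩ := hu
  rw [h s x [] (by simp) hx] at hne
  exact hne rfl

theorem Pending.of_concat (hS : FactorialSet S) {u : List (Letter A)} {b : Letter A}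
    (hl : w.length ≤ u.length) (h : u ++ [b] ∈ Pending S w) : u ∈ Pending S w := by
  refine ⟨hS _ h.1 _ ⟨[], [b], by simp⟩, ?_, ?_⟩
  · obtain ⟨x, hx, hxu⟩ := h.2.1
    exact ⟨x, hx, List.prefix_of_prefix_length_le hxu (List.prefix_append u [b])
      (by rwa [length_of_mem_pair hx])⟩
  · intro s x t hu hx
    exact h.2.2 s x (t ++ [b]) (by simp [hu]) hx

theorem CR.pending_of_concat (hS : FactorialSet S) {u : List (Letter A)} {b : Letter A}
    (h : u ++ [b] ∈ CR S w) : u ∈ Pending S w := by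
  have hl : w.length ≤ u.length := by
    have := CR.length_lt h
    simp at this
    omega
  obtain ⟨⟨hmem, ⟨x, hx, hxu, -⟩, -⟩, hno⟩ := h
  refine ⟨hS _ hmem _ ⟨[], [b], by simp⟩, ?_, ?_⟩
  · exact ⟨x, hx, List.prefix_of_prefix_length_le hxu (List.prefix_append u [b])
      (by rwa [length_of_mem_pair hx])⟩
  · intro s x t hu hx
    by_contra hs
    exact hno ⟨s, x, t ++ [b], by simp [hu], hx, hs, by simp⟩

theorem CR.wordInv_mem (hS : ∀ u ∈ S, wordInv u ∈ S) {u : List (Letter A)} (hu : u ∈ CR S w) :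
    wordInv u ∈ CR S w := by
  obtain ⟨⟨hmem, ⟨p, hp, ⟨t, rfl⟩, hpne⟩, ⟨q, hq, ⟨s, hs⟩, hqne⟩⟩, hno⟩ := hu
  refine ⟨⟨hS _ hmem, ⟨wordInv q, wordInv_mem_pair hq, ⟨wordInv s, ?_⟩, ?_⟩,
    ⟨wordInv p, wordInv_mem_pair hp, ⟨wordInv t, ?_⟩, ?_⟩⟩, ?_⟩
  · rw [← hs, wordInv_append]
  · intro h
    apply hqne
    rw [← wordInv_wordInv q, h, wordInv_wordInv]
  · rw [wordInv_append]
  · intro h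
    apply hpne
    have := congrArg wordInv h
    rwa [wordInv_wordInv, wordInv_wordInv] at this
  · rintro ⟨a, v, b, hab, hv, ha, hb⟩
    refine hno ⟨wordInv b, wordInv v, wordInv a, ?_, wordInv_mem_pair hv, wordInv_ne_nil hb,
      wordInv_ne_nil ha⟩
    rw [← wordInv_wordInv (p ++ t), hab]
    simp [wordInv_append]

end Returns

namespace IsTreeSet

open Classical in
/-- The pending words of a given length. -/
noncomputable def pendingOfLength {A : Type*} [Fintype A] (S : Set (List (Letter A)))
    (w : List (Letter A)) (m : ℕ) : Finset (List (Letter A)) :=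
  {u ∈ wordsOfLength A m | u ∈ Pending S w}

open Classical in
/-- The complete first return words of a given length. -/
noncomputable def returnsOfLength {A : Type*} [Fintype A] (S : Set (List (Letter A)))
    (w : List (Letter A)) (m : ℕ) : Finset (List (Letter A)) :=
  {u ∈ wordsOfLength A m | u ∈ CR S w}

variable {A : Type*} [Fintype A] {S : Set (List (Letter A))} {w : List (Letter A)}

theorem mem_pendingOfLength {m : ℕ} {u : List (Letter A)} :
    u ∈ pendingOfLength S w m ↔ u.length = m ∧ u ∈ Pending S w := by
  simp [pendingOfLength, mem_wordsOfLength]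

theorem mem_returnsOfLength {m : ℕ} {u : List (Letter A)} :
    u ∈ returnsOfLength S w m ↔ u.length = m ∧ u ∈ CR S w := by
  simp [returnsOfLength, mem_wordsOfLength]

theorem sum_pending_le (hne : w ≠ []) (f : List (Letter A) → ℝ) (hf : ∀ u, 0 ≤ f u)
    (hadd : ∀ u, u ≠ [] → ∑ c : Letter A, f (c :: u) = f u) (n M : ℕ) :
    ∑ m ∈ Finset.range M, ∑ u ∈ pendingOfLength S w (n + m), f u ≤ ∑ c : Letter A, f [c] := by
  classical
  rw [← Finset.sum_biUnion]
  · refine sum_suffixCode_le f hf hadd _ ?_ ?_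
    · intro y hy
      simp only [Finset.mem_biUnion, mem_pendingOfLength] at hy
      obtain ⟨_, _, _, hy⟩ := hy
      exact Pending.ne_nil hne hy
    · intro y hy y' hy' h
      simp only [Finset.mem_biUnion, mem_pendingOfLength] at hy hy'
      obtain ⟨_, _, _, hy⟩ := hy
      obtain ⟨_, _, _, hy'⟩ := hy'
      exact Pending.eq_of_suffix hy hy' h
  · intro a _ b _ hab
    rw [Function.onFun, Finset.disjoint_left]
    intro u hu hu'
    rw [mem_pendingOfLength] at hu hu'
    exact hab (by omega)

theorem sum_excess_pending_le (hS : IsTreeSet S) (hne : w ≠ []) (n M : ℕ) :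
    ∑ m ∈ Finset.range M, ∑ u ∈ pendingOfLength S w (n + m), excess S u ≤
      2 * Fintype.card A - 2 := by
  rw [← hS.sum_excess_letter]
  exact sum_pending_le hne _ hS.excess_nonneg hS.sum_excess_cons n M

theorem card_returns_add_card_pending_le (hS : IsTreeSet S) {m : ℕ} (hm : w.length ≤ m) :
    ((returnsOfLength S w (m + 1)).card : ℝ) + (pendingOfLength S w (m + 1)).card ≤
      (pendingOfLength S w m).card + ∑ u ∈ pendingOfLength S w m, excess S u := by
  classical
  have hdisj : Disjoint (returnsOfLength S w (m + 1)) (pendingOfLength S w (m + 1)) := by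
    rw [Finset.disjoint_left]
    intro u hu hu'
    rw [mem_returnsOfLength] at hu
    rw [mem_pendingOfLength] at hu'
    exact CR.notMem_pending hu.2 hu'.2
  have hsub : returnsOfLength S w (m + 1) ∪ pendingOfLength S w (m + 1) ⊆
      (pendingOfLength S w m).biUnion fun p =>
        ({b | p ++ [b] ∈ S} : Finset (Letter A)).image fun b => p ++ [b] := by
    intro u hu
    have hl : u.length = m + 1 := by
      rw [Finset.mem_union, mem_returnsOfLength, mem_pendingOfLength] at hu
      tauto
    have hu0 : u ≠ [] := by rintro rfl; simp at hl
    obtain ⟨p, b, rfl⟩ : ∃ p b, u = p ++ [b] :=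
      ⟨u.dropLast, u.getLast hu0, (List.dropLast_append_getLast hu0).symm⟩
    have hpl : p.length = m := by simpa using hl
    have hp : p ∈ Pending S w ∧ p ++ [b] ∈ S := by
      rw [Finset.mem_union, mem_returnsOfLength, mem_pendingOfLength] at hu
      rcases hu with ⟨-, hu⟩ | ⟨-, hu⟩
      · exact ⟨CR.pending_of_concat hS.factorial hu, hu.1.1⟩
      · exact ⟨Pending.of_concat hS.factorial (by omega) hu, hu.1⟩
    simp only [Finset.mem_biUnion, Finset.mem_image, Finset.mem_filter_univ]
    exact ⟨p, mem_pendingOfLength.mpr ⟨hpl, hp.1⟩, b, hp.2, rfl⟩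
  have h1 := (Finset.card_le_card hsub).trans Finset.card_biUnion_le
  rw [Finset.card_union_of_disjoint hdisj] at h1
  have h2 : ((∑ p ∈ pendingOfLength S w m,
      (({b | p ++ [b] ∈ S} : Finset (Letter A)).image fun b => p ++ [b]).card : ℕ) : ℝ) =
      (pendingOfLength S w m).card + ∑ u ∈ pendingOfLength S w m, excess S u := by
    push_cast
    rw [← nsmul_one, ← Finset.sum_const, ← Finset.sum_add_distrib]
    refine Finset.sum_congr rfl fun p hp => ?_
    rw [excess, if_pos (mem_pendingOfLength.mp hp).2.1, Finset.card_image_of_injective,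
      Set.ncard_eq_toFinset_card']
    · simp
    · intro a b h
      simpa using h
  rw [← h2]
  exact_mod_cast h1

theorem sum_card_returns_le (hS : IsTreeSet S) (hne : w ≠ []) (M : ℕ) :
    ∑ m ∈ Finset.range M, ((returnsOfLength S w (w.length + m + 1)).card : ℝ) ≤
      2 * Fintype.card A := by
  classical
  have h0 : ((pendingOfLength S w w.length).card : ℝ) ≤ 2 := by
    have : pendingOfLength S w w.length ⊆ {w, wordInv w} := by
      intro u hu
      rw [mem_pendingOfLength] at hu
      obtain ⟨hl, -, ⟨x, hx, hxu⟩, -⟩ := hu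
      have hxe := hxu.eq_of_length (by rw [hl, length_of_mem_pair hx])
      subst hxe
      simpa using hx
    exact_mod_cast (Finset.card_le_card this).trans Finset.card_le_two
  have h1 : ∀ M : ℕ,
      ∑ m ∈ Finset.range M, ((returnsOfLength S w (w.length + m + 1)).card : ℝ) +
        (pendingOfLength S w (w.length + M)).card ≤
      2 + ∑ m ∈ Finset.range M, ∑ u ∈ pendingOfLength S w (w.length + m), excess S u := by
    intro M
    induction M with
    | zero => simpa using h0
    | succ M ih =>
      rw [Finset.sum_range_succ, Finset.sum_range_succ]
      have := hS.card_returns_add_card_pending_le (w := w) (m := w.length + M) (by omega)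
      rw [← add_assoc w.length M 1]
      linarith
  have h2 := h1 M
  have h3 := hS.sum_excess_pending_le hne w.length M
  have h4 : (0 : ℝ) ≤ (pendingOfLength S w (w.length + M)).card := by positivity
  linarith

theorem weight_concat_eq (hS : IsTreeSet S) {μ : List (Letter A) → ℝ} (h0 : ∀ u, 0 ≤ μ u)
    (hpos : ∀ u, u ∈ S ↔ 0 < μ u) (hr : ∀ u, ∑ c : Letter A, μ (u ++ [c]) = μ u)
    {u : List (Letter A)} {b : Letter A} (hu : u ++ [b] ∈ S) (he : excess S u < 1) :
    μ (u ++ [b]) = μ u := by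
  have hmem : u ∈ S := hS.mem_of_isInfix hu ⟨[], [b], by simp⟩
  rw [excess, if_pos hmem] at he
  have h1 : {b | u ++ [b] ∈ S}.ncard ≤ 1 := by
    have : ({b | u ++ [b] ∈ S}.ncard : ℝ) < 2 := by linarith
    have : {b | u ++ [b] ∈ S}.ncard < 2 := by exact_mod_cast this
    omega
  rw [Set.ncard_le_one_iff] at h1
  rw [← hr u, Finset.sum_eq_single b]
  · intro c _ hc
    refine le_antisymm (not_lt.mp fun h => hc ?_) (h0 _)
    exact h1 ((hpos _).mpr h) hu
  · simp

/-- Every sufficiently long word of `S` starting with `w` or `w⁻¹` contains another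
occurrence of `w` or `w⁻¹`. -/
theorem exists_pending_length_lt (hS : IsTreeSet S) (hne : w ≠ []) :
    ∃ M, w.length ≤ M ∧ ∀ u ∈ Pending S w, u.length < M := by
  obtain ⟨μ, h0, hpos, hl, hr⟩ := hS.weight
  by_contra! hcon
  have hnonempty : ∀ m, w.length ≤ m → (pendingOfLength S w m).Nonempty := by
    intro m hm
    obtain ⟨u, hu, hum⟩ := hcon m hm
    obtain ⟨j, hj⟩ := Nat.exists_eq_add_of_le hum
    induction j generalizing u with
    | zero => exact ⟨u, mem_pendingOfLength.mpr ⟨by simpa using hj, hu⟩⟩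
    | succ j ih =>
      have hu0 : u ≠ [] := by rintro rfl; simp at hj
      obtain ⟨p, b, rfl⟩ : ∃ p b, u = p ++ [b] :=
        ⟨u.dropLast, u.getLast hu0, (List.dropLast_append_getLast hu0).symm⟩
      simp at hj
      exact ih p (Pending.of_concat hS.factorial (by omega) hu) (by omega) (by omega)
  have hsum : Summable fun m => ∑ u ∈ pendingOfLength S w (w.length + m), excess S u :=
    summable_of_sum_range_le (fun m => Finset.sum_nonneg fun u _ => hS.excess_nonneg u)
      (hS.sum_excess_pending_le hne w.length)
  obtain ⟨m0, hm0⟩ := Filter.eventually_atTop.mp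
    (hsum.tendsto_atTop_zero.eventually (gt_mem_nhds one_pos))
  have hex : ∀ m ≥ w.length + m0, ∀ u ∈ pendingOfLength S w m, excess S u < 1 := by
    intro m hm u hu
    obtain ⟨j, rfl⟩ := Nat.exists_eq_add_of_le (show w.length ≤ m by omega)
    exact (Finset.single_le_sum (fun u _ => hS.excess_nonneg u) hu).trans_lt (hm0 j (by omega))
  set n := w.length + m0 with hn
  obtain ⟨u0, hu0, hmin⟩ := (pendingOfLength S w n).exists_min_image μ (hnonempty n (by omega))
  have hε : 0 < μ u0 := (hpos _).mp (mem_pendingOfLength.mp hu0).2.1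
  have hlow : ∀ j, ∀ u ∈ pendingOfLength S w (n + j), μ u0 ≤ μ u := by
    intro j
    induction j with
    | zero => exact hmin
    | succ j ih =>
      intro u hu
      rw [mem_pendingOfLength] at hu
      have hune : u ≠ [] := by rintro rfl; simp at hu
      obtain ⟨p, b, rfl⟩ : ∃ p b, u = p ++ [b] :=
        ⟨u.dropLast, u.getLast hune, (List.dropLast_append_getLast hune).symm⟩
      have hpl : p.length = n + j := by
        have := hu.1
        simp at this
        omega
      have hp := mem_pendingOfLength.mpr ⟨hpl, Pending.of_concat hS.factorial (by omega) hu.2⟩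
      rw [hS.weight_concat_eq h0 hpos hr hu.2.1 (hex _ (by omega) p hp)]
      exact ih p hp
  obtain ⟨J, hJ⟩ := exists_nat_gt ((∑ c : Letter A, μ [c]) / μ u0)
  rw [div_lt_iff₀ hε] at hJ
  have h1 := sum_pending_le (S := S) hne μ h0 (fun u _ => hl u) n J
  have h2 : ∑ _m ∈ Finset.range J, μ u0 ≤
      ∑ m ∈ Finset.range J, ∑ u ∈ pendingOfLength S w (n + m), μ u := by
    refine Finset.sum_le_sum fun m _ => ?_
    obtain ⟨u, hu⟩ := hnonempty (n + m) (by omega)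
    exact (hlow m u hu).trans (Finset.single_le_sum (fun u _ => h0 u) hu)
  rw [Finset.sum_const, Finset.card_range, nsmul_eq_mul] at h2
  linarith

/-- There are finitely many complete first return words, and at most twice as many as
letters. -/
theorem finite_CR (hS : IsTreeSet S) (hne : w ≠ []) :
    (CR S w).Finite ∧ (CR S w).ncard ≤ 2 * Fintype.card A := by
  classical
  obtain ⟨M, hM, hlt⟩ := hS.exists_pending_length_lt hne
  have hsub : CR S w ⊆ ((Finset.range M).biUnion fun m =>
      returnsOfLength S w (w.length + m + 1) : Finset _) := by
    intro u hu
    have hl := CR.length_lt hu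
    have hu0 : u ≠ [] := by rintro rfl; simp at hl
    obtain ⟨p, b, rfl⟩ : ∃ p b, u = p ++ [b] :=
      ⟨u.dropLast, u.getLast hu0, (List.dropLast_append_getLast hu0).symm⟩
    have hp := hlt p (CR.pending_of_concat hS.factorial hu)
    simp at hl
    simp only [Finset.coe_biUnion, Set.mem_iUnion, Finset.mem_coe, Finset.mem_range,
      mem_returnsOfLength]
    exact ⟨p.length - w.length, by omega, by simp; omega, hu⟩
  have hfin := (Finset.finite_toSet _).subset hsub
  refine ⟨hfin, ?_⟩
  have h1 := Set.ncard_le_ncard hsub (Finset.finite_toSet _)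
  rw [Set.ncard_coe_finset] at h1
  have h2 := h1.trans Finset.card_biUnion_le
  have h3 := hS.sum_card_returns_le hne M
  have h4 : ∑ m ∈ Finset.range M, (returnsOfLength S w (w.length + m + 1)).card ≤
      2 * Fintype.card A := by exact_mod_cast h3
  exact h2.trans h4

end IsTreeSet

section Coset

variable {A : Type*} {S : Set (List (Letter A))} {w : List (Letter A)}

open Classical in
/-- The correction attached to an occurrence of `w` or `w⁻¹`. -/
noncomputable def correction (w x : List (Letter A)) : FreeGroup A :=
  if x = w then FreeGroup.mk w else 1

theorem correction_wordInv (hw : Reduced w) (hne : w ≠ []) {x : List (Letter A)}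
    (hx : x ∈ ({w, wordInv w} : Set _)) :
    correction w (wordInv x) = (FreeGroup.mk x)⁻¹ * correction w x := by
  have h := hw.wordInv_ne hne
  rcases hx with rfl | rfl
  · simp only [correction, if_true, if_neg h]
    exact (inv_mul_cancel _).symm
  · rw [wordInv_wordInv, mk_wordInv]
    simp [correction, h]

/-- Occurrences of `w` and `w⁻¹` in a reduced word do not overlap. -/
theorem suffix_wordInv_of_append_eq (hw : Reduced w) {s t : List (Letter A)}
    (h : w ++ t = s ++ wordInv w) : wordInv w <:+ t := by
  rcases List.append_eq_append_iff.mp h with ⟨o, rfl, rfl⟩ | ⟨o, ho, ho'⟩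
  · exact List.suffix_append _ _
  · by_cases hone : o = []
    · subst hone
      simp at ho'
      rw [ho']
    · exfalso
      have h1 : wordInv o ++ wordInv s = o ++ t := by rw [← wordInv_append, ← ho, ho']
      have h2 := (List.append_inj h1 (length_wordInv o)).1
      exact (hw.of_isInfix ⟨s, [], by simp [← ho]⟩).wordInv_ne hone h2

open Classical in
theorem mk_NN (hw : Reduced w) (hne : w ≠ []) {x x' s t : List (Letter A)}
    (hx : x ∈ ({w, wordInv w} : Set _)) (hx' : x' ∈ ({w, wordInv w} : Set _))
    (h : x ++ t = s ++ x') :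
    FreeGroup.mk (NN w (x ++ t)) =
      (correction w x)⁻¹ * FreeGroup.mk s * correction w x' := by
  have hww := hw.wordInv_ne hne
  have hgrp := congrArg FreeGroup.mk h
  rw [← FreeGroup.mul_mk, ← FreeGroup.mul_mk] at hgrp
  have hlen := length_wordInv w
  have hend : x' = w → ∀ r : List (Letter A), r <:+ x ++ t → ¬ wordInv w <:+ r := by
    rintro rfl r hr hcon
    have h1 : wordInv x' <:+ s ++ x' := h ▸ hcon.trans hr
    rcases List.suffix_or_suffix_of_suffix h1 (List.suffix_append s x') with h2 | h2
    · exact hww (h2.eq_of_length hlen)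
    · exact hww (h2.eq_of_length hlen.symm).symm
  rcases hx with rfl | rfl
  · have hpre : x <+: x ++ t := List.prefix_append _ _
    have hdrop : (if x <+: x ++ t then (x ++ t).drop x.length else x ++ t) = t := by
      rw [if_pos hpre, List.drop_left]
    simp only [NN]
    rw [hdrop]
    rcases hx' with rfl | rfl
    · rw [if_neg (hend rfl t (List.suffix_append _ _))]
      simp only [correction, if_true]
      rw [mul_assoc, ← hgrp, inv_mul_cancel_left]
    · have hsuf := suffix_wordInv_of_append_eq hw h
      rw [if_pos hsuf]
      obtain ⟨r, rfl⟩ := hsuf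
      have h3 : (r ++ wordInv x).take ((r ++ wordInv x).length - x.length) = r := by
        simp [hlen]
      rw [h3]
      rw [← List.append_assoc] at h
      have h4 := List.append_cancel_right h
      rw [← h4, ← FreeGroup.mul_mk]
      simp only [correction, if_true, if_neg hww, mul_one]
      exact (inv_mul_cancel_left _ _).symm
  · have hpre : ¬ w <+: wordInv w ++ t := by
      intro hcon
      have h2 := List.prefix_of_prefix_length_le hcon (List.prefix_append (wordInv w) t) hlen.ge
      exact hww (h2.eq_of_length hlen.symm).symm
    have hdrop : (if w <+: wordInv w ++ t then (wordInv w ++ t).drop w.length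
        else wordInv w ++ t) = wordInv w ++ t := if_neg hpre
    simp only [NN]
    rw [hdrop]
    rcases hx' with rfl | rfl
    · rw [if_neg (hend rfl _ List.suffix_rfl), ← FreeGroup.mul_mk, hgrp]
      simp [correction, hww]
    · rw [h, if_pos (List.suffix_append _ _)]
      have h3 : (s ++ wordInv w).take ((s ++ wordInv w).length - w.length) = s := by
        simp [hlen]
      rw [h3]
      simp [correction, hww]

theorem mk_NN_wordInv (hw : Reduced w) (hne : w ≠ []) {u : List (Letter A)}
    (hu : CompleteReturnWord S {w, wordInv w} u) :
    FreeGroup.mk (NN w (wordInv u)) = (FreeGroup.mk (NN w u))⁻¹ := by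
  obtain ⟨-, ⟨x, hx, ⟨t, rfl⟩, -⟩, ⟨x', hx', ⟨s, hs⟩, -⟩⟩ := hu
  rw [mk_NN hw hne hx hx' hs.symm]
  have h1 : wordInv (x ++ t) = wordInv x' ++ wordInv s := by rw [← hs, wordInv_append]
  rw [h1, mk_NN hw hne (wordInv_mem_pair hx') (wordInv_mem_pair hx)
    (s := wordInv t) (by rw [← wordInv_append, ← wordInv_append, hs]),
    correction_wordInv hw hne hx, correction_wordInv hw hne hx', mk_wordInv]
  have hgrp := congrArg FreeGroup.mk hs
  rw [← FreeGroup.mul_mk, ← FreeGroup.mul_mk] at hgrp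
  have h2 : FreeGroup.mk x' = (FreeGroup.mk s)⁻¹ * (FreeGroup.mk x * FreeGroup.mk t) := by
    rw [← hgrp, inv_mul_cancel_left]
  rw [h2]
  group

/-- Two occurrences of `w` or `w⁻¹` at both ends of a word of `S` differ by an element of
any subgroup containing the mixed first return words. -/
theorem correction_mem_of_ends (hS : FactorialSet S) (hw : Reduced w) (hne : w ≠ [])
    (H : Subgroup (FreeGroup A)) (hH : ∀ u ∈ CR S w, FreeGroup.mk (NN w u) ∈ H)
    {x x' s t : List (Letter A)} (hx : x ∈ ({w, wordInv w} : Set _))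
    (hx' : x' ∈ ({w, wordInv w} : Set _)) (h : x ++ t = s ++ x') (hmem : x ++ t ∈ S) :
    (correction w x)⁻¹ * FreeGroup.mk s * correction w x' ∈ H := by
  induction hn : (x ++ t).length using Nat.strong_induction_on generalizing x x' s t with
  | _ n ih =>
    subst hn
    have hl := length_of_mem_pair hx
    have hl' := length_of_mem_pair hx'
    have hlen := congrArg List.length h
    simp only [List.length_append] at hlen
    by_cases ht : t = []
    · subst ht
      have hs : s = [] := by
        rw [← List.length_eq_zero_iff]
        simp at hlen
        omega
      subst hs
      simp at h
      subst h
      have : (FreeGroup.mk [] : FreeGroup A) = 1 := rfl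
      simp [this]
    · have hs : s ≠ [] := by
        rintro rfl
        apply ht
        rw [← List.length_eq_zero_iff]
        simp at hlen
        omega
      by_cases hCR : x ++ t ∈ CR S w
      · rw [← mk_NN hw hne hx hx' h]
        exact hH _ hCR
      · have hret : CompleteReturnWord S {w, wordInv w} (x ++ t) :=
          ⟨hmem, ⟨x, hx, List.prefix_append _ _, by simpa using ht⟩,
            ⟨x', hx', h ▸ List.suffix_append _ _, by rw [h]; simpa using hs⟩⟩
        have hint : ∃ p v q, x ++ t = p ++ v ++ q ∧ v ∈ ({w, wordInv w} : Set _) ∧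
            p ≠ [] ∧ q ≠ [] := by
          by_contra hcon
          exact hCR ⟨hret, hcon⟩
        obtain ⟨p, v, q, hpvq, hv, hp, hq⟩ := hint
        have hlv := length_of_mem_pair hv
        have hp' := List.length_pos_iff.mpr hp
        have hq' := List.length_pos_iff.mpr hq
        obtain ⟨t1, ht1⟩ : x <+: p ++ v :=
          List.prefix_of_prefix_length_le (l₃ := x ++ t) (List.prefix_append _ _)
            (hpvq ▸ List.prefix_append _ _) (by simp; omega)
        obtain ⟨s2, hs2⟩ : x' <:+ v ++ q :=
          List.suffix_of_suffix_length_le (l₃ := x ++ t) (h ▸ List.suffix_append _ _)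
            (by rw [hpvq, List.append_assoc]; exact List.suffix_append _ _) (by simp; omega)
        have hlen2 := congrArg List.length hpvq
        simp only [List.length_append] at hlen2
        have hlen3 := congrArg List.length ht1
        simp only [List.length_append] at hlen3
        have h1 := ih (x ++ t1).length (by simp; omega) hx hv ht1
          (hS _ hmem _ (by rw [ht1, hpvq]; exact ⟨[], q, by simp⟩)) rfl
        have h2 := ih (v ++ q).length (by simp; omega) hv hx' hs2.symm
          (hS _ hmem _ (by rw [hpvq]; exact ⟨p, [], by simp⟩)) rfl
        have h3 : s = p ++ s2 := by
          apply List.append_cancel_right (bs := x')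
          rw [← h, hpvq, List.append_assoc, ← hs2, List.append_assoc]
        have h4 := H.mul_mem h1 h2
        rw [h3, ← FreeGroup.mul_mk]
        convert h4 using 1
        group

theorem correction_mem (hS : FactorialSet S) (hw : Reduced w) (hne : w ≠ [])
    (H : Subgroup (FreeGroup A)) (hH : ∀ u ∈ CR S w, FreeGroup.mk (NN w u) ∈ H)
    {s x t s' x' t' : List (Letter A)} (hx : x ∈ ({w, wordInv w} : Set _))
    (hx' : x' ∈ ({w, wordInv w} : Set _)) (h : s ++ x ++ t = s' ++ x' ++ t')
    (hmem : s ++ x ++ t ∈ S) :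
    (FreeGroup.mk s * correction w x)⁻¹ * (FreeGroup.mk s' * correction w x') ∈ H := by
  wlog hle : s.length ≤ s'.length generalizing s x t s' x' t'
  · have := H.inv_mem (this hx' hx h.symm (h ▸ hmem) (by omega))
    convert this using 1
    group
  obtain ⟨r, rfl⟩ : s <+: s' :=
    List.prefix_of_prefix_length_le (l₃ := s ++ x ++ t) (by simp)
      (by rw [h, List.append_assoc]; exact List.prefix_append _ _) hle
  have h1 : x ++ t = r ++ x' ++ t' := by
    apply List.append_cancel_left (as := s)
    simpa using h
  obtain ⟨t1, ht1⟩ : x <+: r ++ x' :=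
    List.prefix_of_prefix_length_le (l₃ := x ++ t) (List.prefix_append _ _)
      (by rw [h1]; exact List.prefix_append _ _)
      (by simp [length_of_mem_pair hx, length_of_mem_pair hx'])
  have h2 := correction_mem_of_ends hS hw hne H hH hx hx' ht1
    (hS _ hmem _ (by rw [ht1, h]; exact ⟨s, t', by simp⟩))
  rw [← FreeGroup.mul_mk]
  convert h2 using 1
  group

end Coset

namespace IsTreeSet

variable {A : Type*} [Fintype A] {S : Set (List (Letter A))}

/-- A labelling of the words of length `m` of a tree set which is equivariant for the
shift and for inversion is constant, with an invariant value. -/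
theorem exists_fixed_label [Nonempty A] (hS : IsTreeSet S) {α : Type*} [MulAction (FreeGroup A) α]
    (m : ℕ) (κ : List (Letter A) → α)
    (hshift : ∀ a v b, a :: (v ++ [b]) ∈ S → v.length = m →
      κ (a :: v) = FreeGroup.mk [a] • κ (v ++ [b]))
    (hinv : ∀ u ∈ S, u.length = m + 1 → κ (wordInv u) = (FreeGroup.mk u)⁻¹ • κ u) :
    ∃ x0, (∀ u ∈ S, u.length = m + 1 → κ u = x0) ∧
      ∀ c : Letter A, FreeGroup.mk [c] • x0 = x0 := by
  classical
  induction m generalizing κ with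
  | zero =>
    have hA : ∀ c c' : Letter A, κ [c] = κ [c'] := by
      intro c c'
      refine (hS.connected_nil (fun a => κ [c] = κ [Letter.inv a]) ?_ (Letter.inv c)
        (Letter.inv c') (by simp [Letter.inv_inv])) |>.trans (by rw [Letter.inv_inv])
      intro a b hab
      have h1 := hshift a [] b (by simpa using hab) rfl
      have h2 := hinv [a] (hS.letter_mem a) rfl
      rw [wordInv_singleton, h1, List.nil_append, inv_smul_smul] at h2
      rw [h2, Letter.inv_inv]
    obtain ⟨c0⟩ : Nonempty (Letter A) := inferInstance
    refine ⟨κ [c0], ?_, ?_⟩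
    · intro u _ hl
      obtain ⟨c, rfl⟩ := List.length_eq_one_iff.mp hl
      exact hA _ _
    · intro c
      obtain ⟨b, hb⟩ := hS.exists_concat_mem (hS.letter_mem c)
      have h1 := hshift c [] b (by simpa using hb) rfl
      rw [hA c0 b]
      exact h1.symm.trans (hA _ _)
  | succ m ih =>
    have hwd : ∀ v b b', v ≠ [] → v.length = m + 1 → v ++ [b] ∈ S → v ++ [b'] ∈ S →
        κ (v ++ [b]) = κ (v ++ [b']) := by
      intro v b b' hv hl hb hb'
      refine hS.connected v hv
        (fun a => (FreeGroup.mk [a])⁻¹ • κ (a :: v) = κ (v ++ [b]))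
        (fun c => κ (v ++ [b]) = κ (v ++ [c])) ?_ b b' hb hb' rfl
      intro a c hac
      rw [hshift a v c hac hl, inv_smul_smul]
      exact eq_comm
    let κ' : List (Letter A) → α := fun v =>
      if h : ∃ b, v ++ [b] ∈ S then κ (v ++ [h.choose]) else κ v
    have hκ' : ∀ v b, v.length = m + 1 → v ++ [b] ∈ S → κ' v = κ (v ++ [b]) := by
      intro v b hl hb
      have h : ∃ b, v ++ [b] ∈ S := ⟨b, hb⟩
      simp only [κ', dif_pos h]
      exact hwd v _ _ (by rintro rfl; simp at hl) hl h.choose_spec hb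
    have hs : ∀ a v b, a :: (v ++ [b]) ∈ S → v.length = m →
        κ' (a :: v) = FreeGroup.mk [a] • κ' (v ++ [b]) := by
      intro a v b hmem hl
      obtain ⟨c, hc⟩ := hS.exists_concat_mem hmem
      have hvb : v ++ [b] ++ [c] ∈ S := hS.mem_of_isInfix hc ⟨[a], [], by simp⟩
      rw [hκ' (a :: v) b (by simp [hl]) (by simpa using hmem),
        hκ' (v ++ [b]) c (by simp [hl]) hvb]
      exact hshift a (v ++ [b]) c (by simpa using hc) (by simp [hl])
    have hi : ∀ u ∈ S, u.length = m + 1 →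
        κ' (wordInv u) = (FreeGroup.mk u)⁻¹ • κ' u := by
      intro u hu hl
      obtain ⟨b, hb⟩ := hS.exists_concat_mem hu
      obtain ⟨a, ha⟩ := hS.exists_cons_mem hb
      have hau : a :: u ∈ S := hS.mem_of_isInfix ha ⟨[], [b], by simp⟩
      have h3 : wordInv u ++ [Letter.inv a] ∈ S := by
        rw [← wordInv_cons]
        exact hS.inv_mem _ hau
      rw [hκ' _ _ (by rw [length_wordInv, hl]) h3, hκ' u b hl hb, ← wordInv_cons,
        hinv _ hau (by simp [hl]), hshift a u b (by simpa using ha) hl, smul_smul]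
      congr 1
      have : FreeGroup.mk (a :: u) = FreeGroup.mk [a] * FreeGroup.mk u := by
        rw [FreeGroup.mul_mk]; rfl
      rw [this]
      group
    obtain ⟨x0, h1, h2⟩ := ih κ' hs hi
    refine ⟨x0, ?_, h2⟩
    intro u hu hl
    have hu0 : u ≠ [] := by rintro rfl; simp at hl
    obtain ⟨p, b, rfl⟩ : ∃ p b, u = p ++ [b] :=
      ⟨u.dropLast, u.getLast hu0, (List.dropLast_append_getLast hu0).symm⟩
    have hpl : p.length = m + 1 := by simpa using hl
    rw [← hκ' p b hpl hu]
    exact h1 p (hS.mem_of_isInfix hu ⟨[], [b], by simp⟩) hpl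

end IsTreeSet

/-- The word `u` contains an occurrence of `w` or `w⁻¹`. -/
def HasOccurrence {A : Type*} (w u : List (Letter A)) : Prop :=
  ∃ s x t, u = s ++ x ++ t ∧ x ∈ ({w, wordInv w} : Set _)

theorem HasOccurrence.inv {A : Type*} {w u : List (Letter A)} (hu : HasOccurrence w u) :
    HasOccurrence w (wordInv u) := by
  obtain ⟨s, x, t, rfl, hx⟩ := hu
  exact ⟨wordInv t, wordInv x, wordInv s, by simp [wordInv_append], wordInv_mem_pair hx⟩

theorem hasOccurrence_of_cons {A : Type*} {S : Set (List (Letter A))}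
    {w : List (Letter A)} {M : ℕ} (hM : ∀ u ∈ Pending S w, u.length < M)
    {a : Letter A} {v : List (Letter A)} (hmem : a :: v ∈ S) (hl : M ≤ v.length + 1)
    (h : HasOccurrence w (a :: v)) : HasOccurrence w v := by
  by_contra hcon
  have h1 : ∀ s x t, a :: v = s ++ x ++ t → x ∈ ({w, wordInv w} : Set _) → s = [] := by
    intro s x t hs hx
    cases s with
    | nil => rfl
    | cons c s =>
      simp only [List.cons_append, List.cons.injEq] at hs
      exact absurd ⟨s, x, t, hs.2, hx⟩ hcon
  obtain ⟨s, x, t, hs, hx⟩ := h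
  have h2 := h1 s x t hs hx
  subst h2
  have := hM (a :: v) ⟨hmem, ⟨x, hx, t, by rw [hs]; rfl⟩, h1⟩
  simp at this
  omega

namespace IsTreeSet

variable {A : Type*} [Fintype A] {S : Set (List (Letter A))} {w : List (Letter A)}

/-- The mixed first return words generate the free group. -/
theorem closure_eq_top (hS : IsTreeSet S) (hw : w ∈ S) (hne : w ≠ [])
    (H : Subgroup (FreeGroup A)) (hH : ∀ u ∈ CR S w, FreeGroup.mk (NN w u) ∈ H) : H = ⊤ := by
  classical
  have hred := hS.reduced w hw
  have hA : Nonempty A := by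
    obtain ⟨c, _⟩ := List.exists_mem_of_ne_nil w hne
    exact ⟨c.1⟩
  obtain ⟨M, hwM, hM⟩ := hS.exists_pending_length_lt hne
  obtain ⟨m, rfl⟩ : ∃ m, M = m + 1 :=
    Nat.exists_eq_succ_of_ne_zero (by have := List.length_pos_iff.mpr hne; omega)
  let κ : List (Letter A) → Option (FreeGroup A ⧸ H) := fun u =>
    if h : HasOccurrence w u then
      some (QuotientGroup.mk (FreeGroup.mk h.choose * correction w h.choose_spec.choose))
    else none
  have hsome : ∀ s x t, s ++ x ++ t ∈ S → x ∈ ({w, wordInv w} : Set _) →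
      κ (s ++ x ++ t) = some (QuotientGroup.mk (FreeGroup.mk s * correction w x)) := by
    intro s x t hmem hx
    have h : HasOccurrence w (s ++ x ++ t) := ⟨s, x, t, rfl, hx⟩
    simp only [κ, dif_pos h, Option.some.injEq]
    obtain ⟨t', ht', hx'⟩ := h.choose_spec.choose_spec
    rw [QuotientGroup.eq]
    exact correction_mem hS.factorial hred hne H hH hx' hx ht'.symm (ht' ▸ hmem)
  have hnone : ∀ u, ¬ HasOccurrence w u → κ u = none := fun u h => dif_neg h
  have hshift : ∀ a v b, a :: (v ++ [b]) ∈ S → v.length = m →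
      κ (a :: v) = FreeGroup.mk [a] • κ (v ++ [b]) := by
    intro a v b hmem hl
    have hav : a :: v ∈ S := hS.mem_of_isInfix hmem ⟨[], [b], by simp⟩
    have hvb : v ++ [b] ∈ S := hS.mem_of_isInfix hmem ⟨[a], [], by simp⟩
    by_cases h : HasOccurrence w v
    · obtain ⟨s, x, t, rfl, hx⟩ := h
      have h1 := hsome (a :: s) x t (by simpa using hav) hx
      have h2 := hsome s x (t ++ [b]) (by simpa using hvb) hx
      have h3 : s ++ x ++ t ++ [b] = s ++ x ++ (t ++ [b]) := by simp
      rw [h3, h2]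
      have h4 : FreeGroup.mk (a :: s) = FreeGroup.mk [a] * FreeGroup.mk s := by
        rw [FreeGroup.mul_mk]; rfl
      rw [h4, mul_assoc] at h1
      exact h1
    · rw [hnone, hnone]
      · rfl
      · intro hcon
        apply h
        have h1 := hcon.inv
        rw [wordInv_append, wordInv_singleton, List.singleton_append] at h1
        have h2 := hS.inv_mem _ hvb
        rw [wordInv_append, wordInv_singleton, List.singleton_append] at h2
        rw [← wordInv_wordInv v]
        exact (hasOccurrence_of_cons hM h2 (by rw [length_wordInv]; omega) h1).inv
      · exact fun hcon => h (hasOccurrence_of_cons hM hav (by omega) hcon)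
  have hinv : ∀ u ∈ S, u.length = m + 1 → κ (wordInv u) = (FreeGroup.mk u)⁻¹ • κ u := by
    intro u hu _
    by_cases h : HasOccurrence w u
    · obtain ⟨s, x, t, rfl, hx⟩ := h
      have h1 : wordInv (s ++ x ++ t) = wordInv t ++ wordInv x ++ wordInv s := by
        simp [wordInv_append]
      have h2 := hsome (wordInv t) (wordInv x) (wordInv s) (h1 ▸ hS.inv_mem _ hu)
        (wordInv_mem_pair hx)
      rw [h1, h2, hsome s x t hu hx, correction_wordInv hred hne hx, mk_wordInv]
      refine congrArg (fun g => some (QuotientGroup.mk g)) ?_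
      rw [← FreeGroup.mul_mk, ← FreeGroup.mul_mk]
      change _ = (FreeGroup.mk s * FreeGroup.mk x * FreeGroup.mk t)⁻¹ *
        (FreeGroup.mk s * correction w x)
      group
    · rw [hnone _ h, hnone]
      · rfl
      · intro hcon
        apply h
        rw [← wordInv_wordInv u]
        exact hcon.inv
  obtain ⟨x0, hconst, hfix⟩ := hS.exists_fixed_label m κ hshift hinv
  obtain ⟨v, hv, hvl⟩ := hS.exists_append_mem hw (m + 1 - w.length)
  have hx0 : x0 = some (QuotientGroup.mk (correction w w)) := by
    rw [← hconst (w ++ v) hv (by rw [List.length_append]; omega)]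
    have := hsome [] w v (by simpa using hv) (by simp)
    rw [List.nil_append] at this
    rw [this]
    exact congrArg (fun g => some (QuotientGroup.mk g)) (one_mul _)
  set g := correction w w
  have hstab : ∀ f : FreeGroup A, f • x0 = x0 := by
    have h1 : ∀ f : FreeGroup A, f ∈ MulAction.stabilizer (FreeGroup A) x0 := by
      intro f
      induction f using FreeGroup.induction_on with
      | C1 => exact one_mem _
      | of a => exact hfix (a, true)
      | inv_of a h => exact Subgroup.inv_mem _ h
      | mul x y hx hy => exact Subgroup.mul_mem _ hx hy
    exact h1
  rw [Subgroup.eq_top_iff']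
  intro f
  have h1 := hstab (g * f * g⁻¹)
  rw [hx0] at h1
  have h2 : (QuotientGroup.mk (g * f * g⁻¹ * g) : FreeGroup A ⧸ H) = QuotientGroup.mk g :=
    Option.some.inj h1
  rw [inv_mul_cancel_right] at h2
  have h3 := QuotientGroup.eq.mp h2.symm
  simpa using h3

/-- The mixed first return words to a nonempty word of a tree set form a symmetric basis
of the free group. -/
theorem isSymmetricBasisOf_MR (hS : IsTreeSet S) (hw : w ∈ S) (hne : w ≠ []) :
    IsSymmetricBasisOf (FreeGroup.mk '' MR S w) (⊤ : Subgroup (FreeGroup A)) := by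
  have hred := hS.reduced w hw
  obtain ⟨hfin, hcard⟩ := hS.finite_CR (w := w) hne
  obtain ⟨D, hD, hDC, hDcard⟩ := exists_half (CR S w) hfin wordInv wordInv_wordInv
    (fun u hu => CR.wordInv_mem hS.inv_mem hu)
    (fun u hu => (hS.reduced u hu.1.1).wordInv_ne (by
      rintro rfl
      exact absurd (CR.length_lt hu) (by simp)))
  let φ : List (Letter A) → FreeGroup A := fun u => FreeGroup.mk (NN w u)
  have hφ : ∀ u ∈ CR S w, φ (wordInv u) = (φ u)⁻¹ := fun u hu => mk_NN_wordInv hred hne hu.1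
  have hDfin := hfin.subset hD
  refine ⟨φ '' D, isBasisOf_top_of_card_le _ (hDfin.image _) ?_ ?_, ?_⟩
  · have := Set.ncard_image_le (f := φ) hDfin
    omega
  · refine hS.closure_eq_top hw hne _ ?_
    intro u hu
    rw [hDC] at hu
    rcases hu with hu | ⟨u, hu, rfl⟩
    · exact Subgroup.subset_closure ⟨u, hu, rfl⟩
    · have : φ (wordInv u) ∈ Subgroup.closure (φ '' D) := by
        rw [hφ u (hD hu)]
        exact Subgroup.inv_mem _ (Subgroup.subset_closure ⟨u, hu, rfl⟩)
      exact this
  · have h1 : FreeGroup.mk '' MR S w = φ '' CR S w := by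
      rw [MR, Set.image_image]
    rw [h1]
    ext g
    constructor
    · rintro ⟨u, hu, rfl⟩
      rw [hDC] at hu
      rcases hu with hu | ⟨u, hu, rfl⟩
      · exact Or.inl ⟨u, hu, rfl⟩
      · refine Or.inr ?_
        rw [hφ u (hD hu), Set.inv_mem_inv]
        exact ⟨u, hu, rfl⟩
    · rintro (⟨u, hu, rfl⟩ | ⟨u, hu, hg⟩)
      · exact ⟨u, hD hu, rfl⟩
      · refine ⟨wordInv u, CR.wordInv_mem hS.inv_mem (hD hu), ?_⟩
        rw [hφ u (hD hu), hg, inv_inv]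

end IsTreeSet

/-- A family of pairwise disjoint (possibly empty) open subintervals of `]p,q[` whose union
is dense. -/
structure IsDenseIntervalFamily {ι : Type*} (p q : ℝ) (J : ι → Set ℝ) : Prop where
  interval : ∀ a, ∃ x y, J a = Ioo x y
  subset : ∀ a, J a ⊆ Ioo p q
  disjoint : ∀ a b, a ≠ b → Disjoint (J a) (J b)
  dense : ∀ x y, p ≤ x → x < y → y ≤ q → ∃ a, (Ioo x y ∩ J a).Nonempty

namespace IsDenseIntervalFamily

variable {ι κ : Type*} {p q : ℝ}

/-- Some member of the family covers a right neighbourhood of any given point. -/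
theorem exists_germ [Finite ι] {l r : ι → ℝ}
    (h : IsDenseIntervalFamily p q fun a => Ioo (l a) (r a)) {x : ℝ} (hp : p ≤ x) (hq : x < q) :
    ∃ a, l a ≤ x ∧ x < r a := by
  by_contra! hcon
  have hev : ∀ a, ∀ᶠ y in nhdsWithin x (Ioi x), y < q ∧ ∀ z, x < z → z < y →
      z ∉ Ioo (l a) (r a) := by
    intro a
    by_cases hl : l a ≤ x
    · filter_upwards [Ioo_mem_nhdsGT hq] with y hy
      exact ⟨hy.2, fun z hz _ hz' => absurd (hz.trans hz'.2) (not_lt.mpr (hcon a hl))⟩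
    · filter_upwards [Ioo_mem_nhdsGT hq, Ioo_mem_nhdsGT (not_le.mp hl)] with y hy hy'
      exact ⟨hy.2, fun z _ hzy hz' => absurd (hzy.trans hy'.2) (not_lt.mpr hz'.1.le)⟩
  have hall := Filter.eventually_all.mpr hev
  obtain ⟨y, hy, hxy, hyq⟩ := (hall.and (Ioo_mem_nhdsGT hq)).exists
  obtain ⟨a, z, hz, hza⟩ := h.dense x y hp hxy hyq.le
  exact (hy a).2 z hz.1 hz.2 hza

theorem eq_of_left_le {l r : ι → ℝ}
    (h : IsDenseIntervalFamily p q fun a => Ioo (l a) (r a)) {a b : ι} {x : ℝ}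
    (ha : l a ≤ x) (ha' : x < r a) (hb : l b ≤ x) (hb' : x < r b) : a = b := by
  by_contra hne
  obtain ⟨y, hy, hy'⟩ := exists_between (lt_min ha' hb')
  rw [lt_min_iff] at hy'
  exact Set.disjoint_left.mp (h.disjoint a b hne) ⟨ha.trans_lt hy, hy'.1⟩ ⟨hb.trans_lt hy, hy'.2⟩

theorem le_left {l r : ι → ℝ}
    (h : IsDenseIntervalFamily p q fun a => Ioo (l a) (r a)) {a : ι} (ha : l a < r a) :
    p ≤ l a ∧ r a ≤ q :=
  (Ioo_subset_Ioo_iff ha).mp (h.subset a)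

/-- If two dense families of intervals cover `]p,q[`, then their intersection graph is
connected. -/
theorem exists_common_value {L : ι → Set ℝ} {R : κ → Set ℝ}
    (hL : IsDenseIntervalFamily p q L) (hR : IsDenseIntervalFamily p q R)
    (hcover : ∀ x ∈ Ioo p q, (∃ a, x ∈ L a) ∨ ∃ b, x ∈ R b)
    (P : ι → Prop) (Q : κ → Prop) (hPQ : ∀ a b, (L a ∩ R b).Nonempty → (P a ↔ Q b)) :
    ∃ t : Prop, (∀ a, (L a).Nonempty → (P a ↔ t)) ∧ ∀ b, (R b).Nonempty → (Q b ↔ t) := by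
  let U : Set ℝ := {x | (∃ a, P a ∧ x ∈ L a) ∨ ∃ b, Q b ∧ x ∈ R b}
  let V : Set ℝ := {x | (∃ a, ¬ P a ∧ x ∈ L a) ∨ ∃ b, ¬ Q b ∧ x ∈ R b}
  have hopen : ∀ (P : ι → Prop) (Q : κ → Prop),
      IsOpen {x | (∃ a, P a ∧ x ∈ L a) ∨ ∃ b, Q b ∧ x ∈ R b} := by
    intro P Q
    have : {x | (∃ a, P a ∧ x ∈ L a) ∨ ∃ b, Q b ∧ x ∈ R b} =
        (⋃ a, ⋃ _ : P a, L a) ∪ ⋃ b, ⋃ _ : Q b, R b := by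
      ext x; simp
    rw [this]
    refine IsOpen.union (isOpen_iUnion fun a => isOpen_iUnion fun _ => ?_)
      (isOpen_iUnion fun b => isOpen_iUnion fun _ => ?_)
    · obtain ⟨x, y, h⟩ := hL.interval a
      exact h ▸ isOpen_Ioo
    · obtain ⟨x, y, h⟩ := hR.interval b
      exact h ▸ isOpen_Ioo
  have hsub : Ioo p q ⊆ U ∪ V := by
    intro x hx
    rcases hcover x hx with ⟨a, ha⟩ | ⟨b, hb⟩
    · by_cases h : P a
      · exact Or.inl (Or.inl ⟨a, h, ha⟩)
      · exact Or.inr (Or.inl ⟨a, h, ha⟩)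
    · by_cases h : Q b
      · exact Or.inl (Or.inr ⟨b, h, hb⟩)
      · exact Or.inr (Or.inr ⟨b, h, hb⟩)
  have hdisj : ∀ x ∈ U, x ∉ V := by
    rintro x (⟨a, h, ha⟩ | ⟨b, h, hb⟩) (⟨a', h', ha'⟩ | ⟨b', h', hb'⟩)
    · exact Set.disjoint_left.mp (hL.disjoint a a' (by rintro rfl; exact h' h)) ha ha'
    · exact h' ((hPQ a b' ⟨x, ha, hb'⟩).mp h)
    · exact h' ((hPQ a' b ⟨x, ha', hb⟩).mpr h)
    · exact Set.disjoint_left.mp (hR.disjoint b b' (by rintro rfl; exact h' h)) hb hb'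
  have hUsub : U ⊆ Ioo p q := by
    rintro x (⟨a, -, ha⟩ | ⟨b, -, hb⟩)
    · exact hL.subset a ha
    · exact hR.subset b hb
  have hVsub : V ⊆ Ioo p q := by
    rintro x (⟨a, -, ha⟩ | ⟨b, -, hb⟩)
    · exact hL.subset a ha
    · exact hR.subset b hb
  have key : U.Nonempty → V.Nonempty → False := by
    rintro ⟨x, hx⟩ ⟨y, hy⟩
    obtain ⟨z, -, hz, hz'⟩ := isPreconnected_Ioo U V (hopen P Q)
      (hopen (fun a => ¬ P a) fun b => ¬ Q b) hsub ⟨x, hUsub hx, hx⟩ ⟨y, hVsub hy, hy⟩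
    exact hdisj z hz hz'
  refine ⟨U.Nonempty, fun a ⟨x, hx⟩ => ⟨fun h => ⟨x, Or.inl ⟨a, h, hx⟩⟩, fun h => ?_⟩,
    fun b ⟨x, hx⟩ => ⟨fun h => ⟨x, Or.inr ⟨b, h, hx⟩⟩, fun h => ?_⟩⟩
  · by_contra hP
    exact key h ⟨x, Or.inl ⟨a, hP, hx⟩⟩
  · by_contra hQ
    exact key h ⟨x, Or.inr ⟨b, hQ, hx⟩⟩

/-- If two dense families of intervals cover `]p,q[`, then their intersection graph has the
number of edges of a tree. -/
theorem ncard_edges [Finite ι] [Finite κ] (hpq : p < q) {L : ι → Set ℝ} {R : κ → Set ℝ}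
    (hL : IsDenseIntervalFamily p q L) (hR : IsDenseIntervalFamily p q R)
    (hcover : ∀ x ∈ Ioo p q, (∃ a, x ∈ L a) ∨ ∃ b, x ∈ R b) :
    {e : ι × κ | (L e.1 ∩ R e.2).Nonempty}.ncard + 1 =
      {a | (L a).Nonempty}.ncard + {b | (R b).Nonempty}.ncard := by
  choose l l' hl using hL.interval
  choose r r' hr using hR.interval
  obtain rfl : L = fun a => Ioo (l a) (l' a) := funext hl
  obtain rfl : R = fun b => Ioo (r b) (r' b) := funext hr
  simp only [nonempty_Ioo, Ioo_inter_Ioo]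
  have hAL : InjOn l {a | l a < l' a} := fun a ha b hb hab =>
    hL.eq_of_left_le le_rfl ha hab.ge (hab.trans_lt hb)
  have hAR : InjOn r {b | r b < r' b} := fun a ha b hb hab =>
    hR.eq_of_left_le le_rfl ha hab.ge (hab.trans_lt hb)
  have hE : InjOn (fun e : ι × κ => l e.1 ⊔ r e.2)
      {e | l e.1 ⊔ r e.2 < l' e.1 ⊓ r' e.2} := by
    rintro ⟨a, b⟩ h ⟨a', b'⟩ h' heq
    have h1 : l a ⊔ r b < l' a ⊓ r' b := h
    have h2 : l a' ⊔ r b' < l' a' ⊓ r' b' := h'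
    have heq' : l a ⊔ r b = l a' ⊔ r b' := heq
    rw [← heq'] at h2
    rw [lt_inf_iff] at h1 h2
    have h3 : l a' ⊔ r b' ≤ l a ⊔ r b := heq'.ge
    rw [sup_le_iff] at h3
    have e1 : a = a' := hL.eq_of_left_le le_sup_left h1.1 h3.1 h2.1
    have e2 : b = b' := hR.eq_of_left_le le_sup_right h1.2 h3.2 h2.2
    rw [e1, e2]
  rw [← hAL.ncard_image, ← hAR.ncard_image, ← hE.ncard_image,
    ← ncard_union_add_ncard_inter _ _ (toFinite _) (toFinite _)]
  have hunion : (fun e : ι × κ => l e.1 ⊔ r e.2) '' {e | l e.1 ⊔ r e.2 < l' e.1 ⊓ r' e.2} =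
      l '' {a | l a < l' a} ∪ r '' {b | r b < r' b} := by
    apply Subset.antisymm
    · rintro _ ⟨⟨a, b⟩, h, rfl⟩
      have h1 : l a ⊔ r b < l' a ⊓ r' b := h
      rw [lt_inf_iff, sup_lt_iff, sup_lt_iff] at h1
      rcases le_total (r b) (l a) with h2 | h2
      · exact Or.inl ⟨a, h1.1.1, (sup_eq_left.mpr h2).symm⟩
      · exact Or.inr ⟨b, h1.2.2, (sup_eq_right.mpr h2).symm⟩
    · rintro _ (⟨a, ha, rfl⟩ | ⟨b, hb, rfl⟩)
      · have h1 := hL.le_left ha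
        have ha' : l a < l' a := ha
        obtain ⟨b, hb, hb'⟩ := hR.exists_germ h1.1 (ha'.trans_le h1.2)
        refine ⟨(a, b), ?_, sup_eq_left.mpr hb⟩
        change l a ⊔ r b < l' a ⊓ r' b
        rw [sup_eq_left.mpr hb]
        exact lt_min ha hb'
      · have h1 := hR.le_left hb
        have hb' : r b < r' b := hb
        obtain ⟨a, ha, ha'⟩ := hL.exists_germ h1.1 (hb'.trans_le h1.2)
        refine ⟨(a, b), ?_, sup_eq_right.mpr ha⟩
        change l a ⊔ r b < l' a ⊓ r' b
        rw [sup_eq_right.mpr ha]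
        exact lt_min ha' hb
  have hinter : l '' {a | l a < l' a} ∩ r '' {b | r b < r' b} = {p} := by
    apply Subset.antisymm
    · rintro x ⟨⟨a, ha, rfl⟩, ⟨b, hb, hab⟩⟩
      have ha' : l a < l' a := ha
      have hb' : r b < r' b := hb
      have h1 := hL.le_left ha
      by_contra hne
      have h2 : l a ∈ Ioo p q :=
        ⟨lt_of_le_of_ne h1.1 fun h => hne h.symm, ha'.trans_le h1.2⟩
      rcases hcover _ h2 with ⟨c, hc⟩ | ⟨c, hc⟩
      · have := hL.eq_of_left_le le_rfl ha hc.1.le hc.2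
        subst this
        exact lt_irrefl _ hc.1
      · have := hR.eq_of_left_le hab.le (hab ▸ hb') hc.1.le hc.2
        subst this
        exact absurd hc.1 (by simp [hab])
    · rintro _ rfl
      obtain ⟨a, ha, ha'⟩ := hL.exists_germ le_rfl hpq
      obtain ⟨b, hb, hb'⟩ := hR.exists_germ le_rfl hpq
      have ea := le_antisymm ha (hL.le_left (ha.trans_lt ha')).1
      have eb := le_antisymm hb (hR.le_left (hb.trans_lt hb')).1
      exact ⟨⟨a, ha.trans_lt ha', ea⟩, ⟨b, hb.trans_lt hb', eb⟩⟩
  rw [hunion, hinter, ncard_singleton]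

end IsDenseIntervalFamily

theorem s2_s2 (z : ℝ × Bool) : s2 (s2 z) = z := by
  simp [s2]

namespace LinearInvolution

variable {A : Type*} [Fintype A] (L : LinearInvolution A)

theorem mem_Ihat {z : ℝ × Bool} : z ∈ L.Ihat ↔ z.1 ∈ Ioo L.lo L.hi := by
  simp [Ihat]

theorem s2_mem_Ihat {z : ℝ × Bool} : s2 z ∈ L.Ihat ↔ z ∈ L.Ihat := by
  simp [mem_Ihat, s2]

theorem mem_Ia {c : Letter A} {z : ℝ × Bool} :
    z ∈ L.Ia c ↔ z.1 ∈ Ioo (L.endLo c) (L.endHi c) ∧ z.2 = L.comp c := by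
  simp [Ia]

theorem Ia_nonempty (c : Letter A) : (L.Ia c).Nonempty := by
  obtain ⟨x, hx⟩ := exists_between (L.end_lt c)
  exact ⟨(x, L.comp c), L.mem_Ia.mpr ⟨hx, rfl⟩⟩

theorem Ia_subset_Ihat (c : Letter A) : L.Ia c ⊆ L.Ihat := by
  intro z hz
  rw [Ihat, L.cover]
  exact Or.inl (mem_iUnion.mpr ⟨c, hz⟩)

theorem notMem_Sig_of_mem_Ia {c : Letter A} {z : ℝ × Bool} (hz : z ∈ L.Ia c) : z ∉ L.Sig :=
  fun h => Set.disjoint_left.mp (L.Sig_disj c) h hz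

theorem eq_of_mem_Ia {c d : Letter A} {z : ℝ × Bool} (hc : z ∈ L.Ia c) (hd : z ∈ L.Ia d) :
    c = d := by
  by_contra h
  exact Set.disjoint_left.mp (L.disj c d h) hc hd

theorem exists_mem_Ia {z : ℝ × Bool} (hz : z ∈ L.Ihat) (hs : z ∉ L.Sig) : ∃ c, z ∈ L.Ia c := by
  rw [Ihat, L.cover] at hz
  rcases hz with hz | hz
  · exact mem_iUnion.mp hz
  · exact absurd hz hs

theorem s1_s1_of_mem_Ia {c : Letter A} {z : ℝ × Bool} (hz : z ∈ L.Ia c) :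
    L.s1 (L.s1 z) = z :=
  L.s1_invol z ⟨L.Ia_subset_Ihat c hz, L.notMem_Sig_of_mem_Ia hz⟩

theorem s1_mem_Ia {c : Letter A} {z : ℝ × Bool} (hz : z ∈ L.Ia c) :
    L.s1 z ∈ L.Ia (Letter.inv c) := by
  have := mem_image_of_mem L.s1 hz
  rwa [Ia, L.s1_image c] at this

theorem s2_T (z : ℝ × Bool) : s2 (L.T z) = L.s1 z := s2_s2 _

/-- The image of `I_c` under `T`. -/
def Ta (c : Letter A) : Set (ℝ × Bool) := {z | s2 z ∈ L.Ia (Letter.inv c)}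

theorem mem_Ta {c : Letter A} {z : ℝ × Bool} :
    z ∈ L.Ta c ↔ z.1 ∈ Ioo (L.endLo (Letter.inv c)) (L.endHi (Letter.inv c)) ∧
      z.2 = !L.comp (Letter.inv c) := by
  change s2 z ∈ L.Ia (Letter.inv c) ↔ _
  rw [mem_Ia]
  simp [s2, Bool.not_eq_eq_eq_not]

theorem T_mem_Ta {c : Letter A} {z : ℝ × Bool} (hz : z ∈ L.Ia c) : L.T z ∈ L.Ta c := by
  change s2 (L.T z) ∈ L.Ia (Letter.inv c)
  rw [s2_T]
  exact L.s1_mem_Ia hz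

theorem Ta_subset_Ihat (c : Letter A) : L.Ta c ⊆ L.Ihat := fun z hz =>
  L.s2_mem_Ihat.mp (L.Ia_subset_Ihat _
    (show s2 z ∈ L.Ia (Letter.inv c) from hz))

theorem exists_T_eq {c : Letter A} {z : ℝ × Bool} (hz : z ∈ L.Ta c) :
    ∃ y ∈ L.Ia c, L.T y = z := by
  have h1 := L.s1_mem_Ia (show s2 z ∈ L.Ia (Letter.inv c) from hz)
  rw [Letter.inv_inv] at h1
  refine ⟨_, h1, ?_⟩
  rw [T, L.s1_s1_of_mem_Ia (show s2 z ∈ L.Ia (Letter.inv c) from hz), s2_s2]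

theorem T_s2_T {c : Letter A} {z : ℝ × Bool} (hz : z ∈ L.Ia c) : L.T (s2 (L.T z)) = s2 z := by
  rw [s2_T, T, L.s1_s1_of_mem_Ia hz]

theorem exists_mem_Ta {z : ℝ × Bool} (hz : z ∈ L.Ihat) (hs : z ∉ s2 '' L.Sig) :
    ∃ c, z ∈ L.Ta c := by
  obtain ⟨c, hc⟩ := L.exists_mem_Ia (L.s2_mem_Ihat.mpr hz)
    (fun h => hs ⟨s2 z, h, s2_s2 z⟩)
  refine ⟨Letter.inv c, ?_⟩
  change s2 z ∈ L.Ia (Letter.inv (Letter.inv c))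
  rwa [Letter.inv_inv]

/-- The set of points whose coding starts with `u`. -/
def J : List (Letter A) → Set (ℝ × Bool)
  | [] => L.Ihat
  | a :: u => L.Ia a ∩ L.T ⁻¹' J u

theorem J_singleton (a : Letter A) : L.J [a] = L.Ia a := by
  refine inter_eq_left.mpr fun z hz => L.Ta_subset_Ihat a (L.T_mem_Ta hz)

theorem J_subset_Ihat (u : List (Letter A)) : L.J u ⊆ L.Ihat := by
  cases u with
  | nil => exact Subset.rfl
  | cons a u => exact inter_subset_left.trans (L.Ia_subset_Ihat a)

theorem mem_J_append {u v : List (Letter A)} {z : ℝ × Bool} :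
    z ∈ L.J (u ++ v) ↔ z ∈ L.J u ∧ (L.T)^[u.length] z ∈ L.J v := by
  induction u generalizing z with
  | nil =>
    simp only [List.nil_append, List.length_nil, Function.iterate_zero, id]
    exact ⟨fun h => ⟨L.J_subset_Ihat v h, h⟩, fun h => h.2⟩
  | cons a u ih =>
    change (z ∈ L.Ia a ∧ L.T z ∈ L.J (u ++ v)) ↔ (z ∈ L.Ia a ∧ L.T z ∈ L.J u) ∧ _
    rw [ih, List.length_cons, Function.iterate_succ_apply, and_assoc]

theorem mem_J_concat {u : List (Letter A)} {b : Letter A} {z : ℝ × Bool} :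
    z ∈ L.J (u ++ [b]) ↔ z ∈ L.J u ∧ (L.T)^[u.length] z ∈ L.Ia b := by
  rw [mem_J_append, J_singleton]

theorem iterate_mem_Ihat {u : List (Letter A)} {z : ℝ × Bool} (hz : z ∈ L.J u) :
    (L.T)^[u.length] z ∈ L.Ihat := by
  have : z ∈ L.J (u ++ []) := by rwa [List.append_nil]
  exact (L.mem_J_append.mp this).2

theorem mem_J_iff {u : List (Letter A)} {z : ℝ × Bool} :
    z ∈ L.J u ↔ z ∈ L.Ihat ∧ L.IsCodingFrom z 0 u := by
  unfold IsCodingFrom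
  simp only [zero_add]
  induction u generalizing z with
  | nil =>
    refine ⟨fun h => ⟨h, fun i => i.elim0⟩, fun h => h.1⟩
  | cons a u ih =>
    change (z ∈ L.Ia a ∧ L.T z ∈ L.J u) ↔ _
    rw [ih]
    constructor
    · rintro ⟨h1, -, h2⟩
      refine ⟨L.Ia_subset_Ihat a h1, fun i => ?_⟩
      refine Fin.cases h1 (fun j => ?_) i
      simpa using h2 j
    · rintro ⟨-, h⟩
      have h1 : z ∈ L.Ia a := h ⟨0, by simp⟩
      refine ⟨h1, L.Ta_subset_Ihat a (L.T_mem_Ta h1), fun j => ?_⟩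
      have := h j.succ
      simpa using this

theorem mem_J_wordInv {u : List (Letter A)} {z : ℝ × Bool} (hz : z ∈ L.J u) :
    s2 ((L.T)^[u.length] z) ∈ L.J (wordInv u) ∧
      (L.T)^[u.length] (s2 ((L.T)^[u.length] z)) = s2 z := by
  induction u generalizing z with
  | nil => exact ⟨L.s2_mem_Ihat.mpr hz, rfl⟩
  | cons a u ih =>
    obtain ⟨h1, h2⟩ : z ∈ L.Ia a ∧ L.T z ∈ L.J u := hz
    obtain ⟨h3, h4⟩ := ih h2
    rw [List.length_cons, Function.iterate_succ_apply]
    constructor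
    · rw [wordInv_cons, mem_J_concat, length_wordInv, h4]
      exact ⟨h3, L.T_mem_Ta h1⟩
    · rw [Function.iterate_succ_apply', h4, L.T_s2_T h1]

theorem reduced_of_mem_J {u : List (Letter A)} {z : ℝ × Bool} (hz : z ∈ L.J u) :
    Reduced u := by
  induction u generalizing z with
  | nil => exact List.IsChain.nil
  | cons a u ih =>
    obtain ⟨h1, h2⟩ : z ∈ L.Ia a ∧ L.T z ∈ L.J u := hz
    cases u with
    | nil => exact List.IsChain.singleton a
    | cons b u =>
      refine List.IsChain.cons_cons ?_ (ih h2)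
      rintro rfl
      have h3 := (L.mem_Ta.mp (L.T_mem_Ta h1)).2
      have h4 := (L.mem_Ia.mp h2.1).2
      rw [h4] at h3
      simp at h3

/-- On `I_c` the map `T` is a translation or a symmetry. -/
theorem exists_isometry (c : Letter A) : ∃ φ : ℝ → ℝ, Function.Injective φ ∧
    MeasureTheory.MeasurePreserving φ ∧
    (∀ p q, ∃ p' q', φ ⁻¹' Ioo p q = Ioo p' q') ∧
    ∀ z ∈ L.Ia c, L.T z = (φ z.1, !L.comp (Letter.inv c)) := by
  rcases L.s1_iso c with ⟨α, h⟩ | ⟨α, h⟩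
  · refine ⟨fun x => x + α, add_left_injective α, MeasureTheory.measurePreserving_add_right _ α,
      fun p q => ⟨p - α, q - α, by simp⟩, fun z hz => ?_⟩
    rw [T, h z hz, s2]
  · refine ⟨fun x => α - x, sub_right_injective, MeasureTheory.Measure.measurePreserving_sub_left _ α,
      fun p q => ⟨α - q, α - p, by simp⟩, fun z hz => ?_⟩
    rw [T, h z hz, s2]
    simp only [Prod.mk.injEq, and_true]
    ring

theorem exists_slice_eq_Ioo (u : List (Letter A)) (δ : Bool) :
    ∃ p q, {x | (x, δ) ∈ L.J u} = Ioo p q := by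
  induction u generalizing δ with
  | nil =>
    refine ⟨L.lo, L.hi, ?_⟩
    ext x
    exact L.mem_Ihat
  | cons a u ih =>
    by_cases hδ : δ = L.comp a
    · obtain ⟨φ, -, -, hφ, hT⟩ := L.exists_isometry a
      obtain ⟨p, q, hpq⟩ := ih (!L.comp (Letter.inv a))
      obtain ⟨p', q', hpq'⟩ := hφ p q
      have : {x | (x, δ) ∈ L.J (a :: u)} = Ioo (L.endLo a) (L.endHi a) ∩ Ioo p' q' := by
        rw [← hpq', ← hpq]
        ext x
        change ((x, δ) ∈ L.Ia a ∧ L.T (x, δ) ∈ L.J u) ↔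
          x ∈ Ioo (L.endLo a) (L.endHi a) ∧ (φ x, !L.comp (Letter.inv a)) ∈ L.J u
        have h1 : (x, δ) ∈ L.Ia a ↔ x ∈ Ioo (L.endLo a) (L.endHi a) := by
          rw [mem_Ia]
          exact and_iff_left hδ
        rw [← h1]
        exact and_congr_right fun h => by rw [hT _ h]
      rw [this, Ioo_inter_Ioo]
      exact ⟨_, _, rfl⟩
    · refine ⟨0, 0, ?_⟩
      rw [Ioo_self, Set.eq_empty_iff_forall_notMem]
      exact fun x hx => hδ (L.mem_Ia.mp hx.1).2

end LinearInvolution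

open MeasureTheory

/-- Lebesgue measure on the two copies of the real line. -/
noncomputable def lam : Measure (ℝ × Bool) :=
  volume.map (fun x => (x, false)) + volume.map (fun x => (x, true))

theorem measurableSet_slice {B : Set (ℝ × Bool)} (hB : MeasurableSet B) (δ : Bool) :
    MeasurableSet {x | (x, δ) ∈ B} :=
  measurable_prodMk_right hB

theorem measurableSet_of_slices {B : Set (ℝ × Bool)}
    (h : ∀ δ, MeasurableSet {x | (x, δ) ∈ B}) : MeasurableSet B := by
  have : B = ⋃ δ : Bool, {x | (x, δ) ∈ B} ×ˢ {δ} := by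
    ext ⟨x, δ⟩
    simp
  rw [this]
  exact MeasurableSet.iUnion fun δ => (h δ).prod (measurableSet_singleton δ)

theorem lam_apply {B : Set (ℝ × Bool)} (hB : MeasurableSet B) :
    lam B = volume {x | (x, false) ∈ B} + volume {x | (x, true) ∈ B} := by
  rw [lam, Measure.add_apply, Measure.map_apply measurable_prodMk_right hB,
    Measure.map_apply measurable_prodMk_right hB]
  rfl

theorem lam_eq_volume_slice {B : Set (ℝ × Bool)} (hB : MeasurableSet B) {δ : Bool}
    (h : ∀ z ∈ B, z.2 = δ) : lam B = volume {x | (x, δ) ∈ B} := by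
  have h0 : {x | (x, !δ) ∈ B} = ∅ := by
    rw [Set.eq_empty_iff_forall_notMem]
    intro x hx
    simpa using h _ hx
  rw [lam_apply hB]
  cases δ
  · rw [Bool.not_false] at h0
    rw [h0, measure_empty, add_zero]
  · rw [Bool.not_true] at h0
    rw [h0, measure_empty, zero_add]

theorem lam_preimage_s2 {B : Set (ℝ × Bool)} (hB : MeasurableSet B) :
    lam (s2 ⁻¹' B) = lam B := by
  have hm : MeasurableSet (s2 ⁻¹' B) :=
    measurableSet_of_slices fun δ => measurableSet_slice hB (!δ)
  rw [lam_apply hm, lam_apply hB, add_comm]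
  rfl

namespace LinearInvolution

variable {A : Type*} [Fintype A] (L : LinearInvolution A)

theorem measurableSet_Ihat : MeasurableSet L.Ihat :=
  measurableSet_Ioo.prod MeasurableSet.univ

theorem measurableSet_Ia (c : Letter A) : MeasurableSet (L.Ia c) :=
  measurableSet_Ioo.prod (measurableSet_singleton _)

theorem measurableSet_Ta (c : Letter A) : MeasurableSet (L.Ta c) :=
  measurableSet_of_slices fun δ => measurableSet_slice (L.measurableSet_Ia (Letter.inv c)) (!δ)

theorem disjoint_Ia {c d : Letter A} (h : c ≠ d) : Disjoint (L.Ia c) (L.Ia d) :=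
  L.disj c d h

theorem disjoint_Ta {c d : Letter A} (h : c ≠ d) : Disjoint (L.Ta c) (L.Ta d) := by
  rw [Set.disjoint_left]
  intro z hc hd
  have := L.eq_of_mem_Ia (z := s2 z) hc hd
  exact h (by rw [← Letter.inv_inv c, this, Letter.inv_inv])

theorem lam_Ihat_lt_top : lam L.Ihat < ⊤ := by
  rw [lam_apply L.measurableSet_Ihat]
  have : ∀ δ, {x | (x, δ) ∈ L.Ihat} = Ioo L.lo L.hi := fun δ => by
    ext x
    exact L.mem_Ihat
  rw [this, this, Real.volume_Ioo]
  exact ENNReal.add_lt_top.mpr ⟨ENNReal.ofReal_lt_top, ENNReal.ofReal_lt_top⟩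

theorem measurableSet_and_lam_inter_preimage_T {B : Set (ℝ × Bool)} (hB : MeasurableSet B)
    (c : Letter A) : MeasurableSet (L.Ia c ∩ L.T ⁻¹' B) ∧
      lam (L.Ia c ∩ L.T ⁻¹' B) = lam (L.Ta c ∩ B) := by
  obtain ⟨φ, hinj, hφ, -, hT⟩ := L.exists_isometry c
  have hTB : MeasurableSet (L.Ta c ∩ B) := (L.measurableSet_Ta c).inter hB
  have hS := measurableSet_slice hTB (!L.comp (Letter.inv c))
  have hslice : {x | (x, L.comp c) ∈ L.Ia c ∩ L.T ⁻¹' B} =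
      φ ⁻¹' {x | (x, !L.comp (Letter.inv c)) ∈ L.Ta c ∩ B} := by
    ext x
    constructor
    · rintro ⟨h1, h2⟩
      have h3 := L.T_mem_Ta h1
      rw [mem_preimage] at h2
      rw [hT _ h1] at h2 h3
      exact ⟨h3, h2⟩
    · rintro ⟨h1, h2⟩
      obtain ⟨⟨y, ε⟩, hy, hyx⟩ := L.exists_T_eq h1
      have hε : ε = L.comp c := (L.mem_Ia.mp hy).2
      subst hε
      have h3 := hyx
      rw [hT _ hy] at h3
      obtain rfl : y = x := hinj (Prod.mk.inj h3).1
      exact ⟨hy, by rwa [mem_preimage, hyx]⟩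
  have hm : MeasurableSet (L.Ia c ∩ L.T ⁻¹' B) := by
    refine measurableSet_of_slices fun δ => ?_
    by_cases hδ : δ = L.comp c
    · rw [hδ, hslice]
      exact hφ.measurable hS
    · convert MeasurableSet.empty
      rw [Set.eq_empty_iff_forall_notMem]
      exact fun x hx => hδ (L.mem_Ia.mp hx.1).2
  refine ⟨hm, ?_⟩
  rw [lam_eq_volume_slice hm fun z hz => (L.mem_Ia.mp hz.1).2, hslice,
    hφ.measure_preimage hS.nullMeasurableSet,
    lam_eq_volume_slice hTB fun z hz => (L.mem_Ta.mp hz.1).2]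

theorem lam_iUnion_preimage_T {B : Set (ℝ × Bool)} (hB : MeasurableSet B)
    (hsub : B ⊆ L.Ihat) :
    ∑ c, lam (L.Ia c ∩ L.T ⁻¹' B) = lam (B \ s2 '' L.Sig) := by
  have h : B \ s2 '' L.Sig = ⋃ c, L.Ta c ∩ B := by
    ext z
    constructor
    · rintro ⟨h1, h2⟩
      obtain ⟨c, hc⟩ := L.exists_mem_Ta (hsub h1) h2
      exact mem_iUnion.mpr ⟨c, hc, h1⟩
    · intro hz
      obtain ⟨c, hc, h1⟩ := mem_iUnion.mp hz
      refine ⟨h1, ?_⟩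
      rintro ⟨y, hy, rfl⟩
      have h2 : s2 (s2 y) ∈ L.Ia (Letter.inv c) := hc
      rw [s2_s2] at h2
      exact L.notMem_Sig_of_mem_Ia h2 hy
  rw [h, measure_iUnion (fun c d hcd => (L.disjoint_Ta hcd).mono inter_subset_left
    inter_subset_left) (fun c => (L.measurableSet_Ta c).inter hB), tsum_fintype]
  exact Finset.sum_congr rfl fun c _ => (L.measurableSet_and_lam_inter_preimage_T hB c).2

theorem measurableSet_Sig : MeasurableSet L.Sig := by
  have : L.Sig = L.Ihat \ ⋃ c, L.Ia c := by
    ext z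
    constructor
    · intro hz
      refine ⟨L.Sig_sub hz, fun h => ?_⟩
      obtain ⟨c, hc⟩ := mem_iUnion.mp h
      exact L.notMem_Sig_of_mem_Ia hc hz
    · rintro ⟨h1, h2⟩
      by_contra h3
      exact h2 (mem_iUnion.mpr (L.exists_mem_Ia h1 h3))
  rw [this]
  exact L.measurableSet_Ihat.diff (MeasurableSet.iUnion L.measurableSet_Ia)

/-- The points whose orbit reaches the division points after exactly `n` steps. -/
def V : ℕ → Set (ℝ × Bool)
  | 0 => L.Sig
  | n + 1 => ⋃ c, L.Ia c ∩ L.T ⁻¹' V n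

theorem V_subset_Ihat (n : ℕ) : L.V n ⊆ L.Ihat := by
  cases n with
  | zero => exact L.Sig_sub
  | succ n => exact iUnion_subset fun c => inter_subset_left.trans (L.Ia_subset_Ihat c)

theorem measurableSet_V (n : ℕ) : MeasurableSet (L.V n) := by
  induction n with
  | zero => exact L.measurableSet_Sig
  | succ n ih =>
    exact MeasurableSet.iUnion fun c => (L.measurableSet_and_lam_inter_preimage_T ih c).1

theorem iterate_mem_Sig_of_mem_V {n : ℕ} {z : ℝ × Bool} (hz : z ∈ L.V n) :
    (L.T)^[n] z ∈ L.Sig := by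
  induction n generalizing z with
  | zero => exact hz
  | succ n ih =>
    obtain ⟨c, -, hc⟩ := mem_iUnion.mp hz
    exact ih hc

theorem mem_iUnion_V {n : ℕ} {z : ℝ × Bool} (hz : z ∈ L.Ihat) (hn : (L.T)^[n] z ∈ L.Sig) :
    z ∈ ⋃ m, L.V m := by
  rw [mem_iUnion]
  induction n generalizing z with
  | zero => exact ⟨0, hn⟩
  | succ n ih =>
    by_cases hs : z ∈ L.Sig
    · exact ⟨0, hs⟩
    · obtain ⟨c, hc⟩ := L.exists_mem_Ia hz hs
      obtain ⟨m, hm⟩ := ih (L.Ta_subset_Ihat c (L.T_mem_Ta hc)) hn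
      exact ⟨m + 1, mem_iUnion.mpr ⟨c, hc, hm⟩⟩

theorem pairwise_disjoint_V : Pairwise (Function.onFun Disjoint L.V) := by
  rw [pairwise_disjoint_on]
  intro m n hmn
  rw [Set.disjoint_left]
  intro z hm hn
  obtain ⟨k, rfl⟩ : ∃ k, n = m + 1 + k := Nat.exists_eq_add_of_le hmn
  clear hmn
  induction m generalizing z with
  | zero =>
    rw [zero_add, Nat.add_comm] at hn
    obtain ⟨c, hc, -⟩ := mem_iUnion.mp hn
    exact L.notMem_Sig_of_mem_Ia hc hm
  | succ m ih =>
    obtain ⟨c, hc, hm'⟩ := mem_iUnion.mp hm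
    rw [show m + 1 + 1 + k = (m + 1 + k) + 1 by omega] at hn
    obtain ⟨d, hd, hn'⟩ := mem_iUnion.mp hn
    exact ih hm' hn'

theorem measurableSet_J (u : List (Letter A)) : MeasurableSet (L.J u) := by
  induction u with
  | nil => exact L.measurableSet_Ihat
  | cons a u ih => exact (L.measurableSet_and_lam_inter_preimage_T ih a).1

variable {L}

theorem lam_V (hnc : ¬ L.HasConnection) (n : ℕ) : lam (L.V n) = lam L.Sig := by
  induction n with
  | zero => rfl
  | succ n ih =>
    have hdisj : L.V n \ s2 '' L.Sig = L.V n := by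
      refine sdiff_eq_left.mpr (Set.disjoint_left.mpr fun z hz hs => ?_)
      exact hnc ⟨z, hs, n, L.iterate_mem_Sig_of_mem_V hz⟩
    rw [← ih, ← hdisj, ← L.lam_iUnion_preimage_T (L.measurableSet_V n) (L.V_subset_Ihat n),
      ← tsum_fintype (L := .unconditional _), ← measure_iUnion]
    · rfl
    · exact fun c d hcd => (L.disjoint_Ia hcd).mono inter_subset_left inter_subset_left
    · exact fun c => (L.measurableSet_and_lam_inter_preimage_T (L.measurableSet_V n) c).1

theorem lam_Sig (hnc : ¬ L.HasConnection) : lam L.Sig = 0 := by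
  by_contra h
  have h1 : ∑' n, lam (L.V n) = lam (⋃ n, L.V n) :=
    (measure_iUnion L.pairwise_disjoint_V L.measurableSet_V).symm
  simp_rw [lam_V hnc] at h1
  rw [ENNReal.tsum_const_eq_top_of_ne_zero h] at h1
  exact (measure_mono (iUnion_subset L.V_subset_Ihat)).trans_lt L.lam_Ihat_lt_top |>.ne h1.symm

theorem lam_iUnion_V (hnc : ¬ L.HasConnection) : lam (⋃ n, L.V n) = 0 :=
  measure_iUnion_null fun n => (lam_V hnc n).trans (lam_Sig hnc)

theorem lam_Ihat_inter_Ohat (hnc : ¬ L.HasConnection) : lam (L.Ihat ∩ L.Ohat) = 0 := by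
  have hsub : L.Ihat ∩ L.Ohat ⊆ (⋃ n, L.V n) ∪ s2 ⁻¹' ⋃ n, L.V n := by
    rintro z ⟨h1, h2 | ⟨y, hy, rfl⟩⟩
    · obtain ⟨n, hn⟩ := mem_iUnion.mp h2
      exact Or.inl (L.mem_iUnion_V h1 hn)
    · obtain ⟨n, hn⟩ := mem_iUnion.mp hy
      refine Or.inr ?_
      rw [mem_preimage, s2_s2]
      exact L.mem_iUnion_V (L.s2_mem_Ihat.mp h1) hn
  refine measure_mono_null hsub (measure_union_null (lam_iUnion_V hnc) ?_)
  rw [lam_preimage_s2 (MeasurableSet.iUnion L.measurableSet_V)]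
  exact lam_iUnion_V hnc

theorem exists_notMem_Ohat (hnc : ¬ L.HasConnection) {x y : ℝ} (hx : L.lo ≤ x) (hxy : x < y)
    (hy : y ≤ L.hi) (δ : Bool) :
    ∃ z ∈ Ioo x y, (z, δ) ∉ L.Ohat := by
  by_contra! h
  have hsub : Ioo x y ×ˢ {δ} ⊆ L.Ihat ∩ L.Ohat := by
    rintro ⟨z, ε⟩ ⟨hz, rfl⟩
    exact ⟨L.mem_Ihat.mpr ⟨hx.trans_lt hz.1, hz.2.trans_le hy⟩, h z hz⟩
  have h0 := measure_mono_null hsub (lam_Ihat_inter_Ohat hnc)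
  rw [lam_eq_volume_slice (measurableSet_Ioo.prod (measurableSet_singleton δ))
    (fun z hz => hz.2)] at h0
  simp only [mem_prod, mem_singleton_iff, and_true, Set.ofPred_mem_eq, Real.volume_Ioo,
    ENNReal.ofReal_eq_zero] at h0
  linarith

end LinearInvolution

theorem ncard_eq_false_add_ncard_eq_true {α : Type*} [Fintype α] (f : α → Bool) :
    {a | f a = false}.ncard + {a | f a = true}.ncard = Fintype.card α := by
  have h : {a | f a = true} = {a | f a = false}ᶜ := by
    ext a
    simp
  rw [h, Set.ncard_add_ncard_compl, Nat.card_eq_fintype_card]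

namespace LinearInvolution

variable {A : Type*} [Fintype A] {L : LinearInvolution A}

theorem exists_slice_of_mem_J {v : List (Letter A)} {x : ℝ} {δ : Bool} (h : (x, δ) ∈ L.J v) :
    ∃ p q, p < q ∧ L.lo ≤ p ∧ q ≤ L.hi ∧ {x | (x, δ) ∈ L.J v} = Ioo p q := by
  obtain ⟨p, q, hpq⟩ := L.exists_slice_eq_Ioo v δ
  have hx : x ∈ Ioo p q := by rwa [← hpq]
  have hlt := hx.1.trans hx.2
  have hsub : Ioo p q ⊆ Ioo L.lo L.hi := by
    rw [← hpq]
    exact fun y hy => L.mem_Ihat.mp (L.J_subset_Ihat v hy)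
  obtain ⟨h1, h2⟩ := (Ioo_subset_Ioo_iff hlt).mp hsub
  exact ⟨p, q, hlt, h1, h2, hpq⟩

theorem notMem_Sig_of_notMem_Ohat {z : ℝ × Bool} (hz : z ∉ L.Ohat) (n : ℕ) :
    (L.T)^[n] z ∉ L.Sig :=
  fun h => hz (Or.inl (mem_iUnion.mpr ⟨n, h⟩))

theorem notMem_image_Sig_of_notMem_Ohat {z : ℝ × Bool} (hz : z ∉ L.Ohat) : z ∉ s2 '' L.Sig := by
  rintro ⟨y, hy, rfl⟩
  exact hz (Or.inr ⟨y, mem_iUnion.mpr ⟨0, hy⟩, rfl⟩)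

theorem iterate_mem_Ihat_of_notMem_Ohat {z : ℝ × Bool} (hz : z ∈ L.Ihat) (hO : z ∉ L.Ohat)
    (n : ℕ) : (L.T)^[n] z ∈ L.Ihat := by
  induction n with
  | zero => exact hz
  | succ n ih =>
    obtain ⟨c, hc⟩ := L.exists_mem_Ia ih (notMem_Sig_of_notMem_Ohat hO n)
    rw [Function.iterate_succ_apply']
    exact L.Ta_subset_Ihat c (L.T_mem_Ta hc)

theorem mem_lang_iff (hnc : ¬ L.HasConnection) {u : List (Letter A)} :
    u ∈ L.lang ↔ (L.J u).Nonempty := by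
  constructor
  · rintro ⟨z, ⟨hz, hO⟩, m, hm⟩
    refine ⟨(L.T)^[m] z, L.mem_J_iff.mpr ⟨iterate_mem_Ihat_of_notMem_Ohat hz hO m, fun i => ?_⟩⟩
    rw [← Function.iterate_add_apply, zero_add, add_comm]
    exact hm i
  · rintro ⟨⟨x, δ⟩, hx⟩
    obtain ⟨p, q, hpq, hp, hq, hJ⟩ := exists_slice_of_mem_J hx
    obtain ⟨z, hz, hO⟩ := exists_notMem_Ohat hnc hp hpq hq δ
    rw [← hJ] at hz
    obtain ⟨h1, h2⟩ := L.mem_J_iff.mp hz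
    exact ⟨(z, δ), ⟨h1, hO⟩, 0, h2⟩

theorem cons_mem_lang_iff (hnc : ¬ L.HasConnection) {a : Letter A} {u : List (Letter A)} :
    a :: u ∈ L.lang ↔ (L.Ta a ∩ L.J u).Nonempty := by
  rw [mem_lang_iff hnc]
  constructor
  · rintro ⟨z, h1, h2⟩
    exact ⟨L.T z, L.T_mem_Ta h1, h2⟩
  · rintro ⟨z, h1, h2⟩
    obtain ⟨y, hy, rfl⟩ := L.exists_T_eq h1
    exact ⟨y, hy, h2⟩

theorem lam_J_ne_top (u : List (Letter A)) : lam (L.J u) ≠ ⊤ :=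
  ((measure_mono (L.J_subset_Ihat u)).trans_lt L.lam_Ihat_lt_top).ne

theorem lam_J_pos_iff {u : List (Letter A)} : 0 < lam (L.J u) ↔ (L.J u).Nonempty := by
  constructor
  · exact fun h => nonempty_of_measure_ne_zero h.ne'
  · rintro ⟨⟨x, δ⟩, hx⟩
    obtain ⟨p, q, hpq, -, -, hJ⟩ := exists_slice_of_mem_J hx
    have hsub : Ioo p q ×ˢ {δ} ⊆ L.J u := by
      rintro ⟨z, ε⟩ ⟨hz, rfl⟩
      rw [← hJ] at hz
      exact hz
    refine lt_of_lt_of_le ?_ (measure_mono hsub)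
    rw [lam_eq_volume_slice (measurableSet_Ioo.prod (measurableSet_singleton δ))
      (fun z hz => hz.2)]
    simpa only [mem_prod, mem_singleton_iff, and_true, Set.ofPred_mem_eq, Real.volume_Ioo,
      ENNReal.ofReal_pos, sub_pos] using hpq

theorem sum_lam_J_cons (hnc : ¬ L.HasConnection) (u : List (Letter A)) :
    ∑ c, lam (L.J (c :: u)) = lam (L.J u) := by
  have h0 : lam (s2 '' L.Sig) = 0 := by
    have : s2 '' L.Sig = s2 ⁻¹' L.Sig :=
      congrFun (image_eq_preimage_of_inverse s2_s2 s2_s2) _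
    rw [this, lam_preimage_s2 L.measurableSet_Sig, lam_Sig hnc]
  rw [← measure_sdiff_null (s := L.J u) h0]
  exact L.lam_iUnion_preimage_T (L.measurableSet_J u) (L.J_subset_Ihat u)

theorem sum_lam_J_concat (hnc : ¬ L.HasConnection) (u : List (Letter A)) :
    ∑ c, lam (L.J (u ++ [c])) = lam (L.J u) := by
  have hsub : L.J u ⊆ (⋃ c, L.J (u ++ [c])) ∪ ⋃ n, L.V n := by
    intro z hz
    by_cases hs : (L.T)^[u.length] z ∈ L.Sig
    · exact Or.inr (L.mem_iUnion_V (L.J_subset_Ihat u hz) hs)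
    · obtain ⟨c, hc⟩ := L.exists_mem_Ia (L.iterate_mem_Ihat hz) hs
      exact Or.inl (mem_iUnion.mpr ⟨c, L.mem_J_concat.mpr ⟨hz, hc⟩⟩)
  rw [← tsum_fintype (L := .unconditional _), ← measure_iUnion _ fun c => L.measurableSet_J _]
  · refine le_antisymm
      (measure_mono (iUnion_subset fun c z hz => (L.mem_J_concat.mp hz).1)) ?_
    refine (measure_mono hsub).trans ((measure_union_le _ _).trans ?_)
    rw [lam_iUnion_V hnc, add_zero]
  · intro c d hcd
    refine Set.disjoint_left.mpr fun z hc hd => hcd ?_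
    exact L.eq_of_mem_Ia (L.mem_J_concat.mp hc).2 (L.mem_J_concat.mp hd).2

variable (L) in
/-- The trace on the component `δ` of the points of `I_v` lying in the image of `I_a`. -/
def leftSlice (v : List (Letter A)) (δ : Bool) (a : Letter A) : Set ℝ :=
  {x | (x, δ) ∈ L.Ta a ∩ L.J v}

variable (L) in
/-- The trace on the component `δ` of the points of `I_v` whose coding continues with `b`. -/
def rightSlice (v : List (Letter A)) (δ : Bool) (b : Letter A) : Set ℝ :=
  {x | (x, δ) ∈ L.J (v ++ [b])}

theorem exists_isDenseIntervalFamily (hnc : ¬ L.HasConnection) {v : List (Letter A)} {x : ℝ}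
    {δ : Bool} (h : (x, δ) ∈ L.J v) : ∃ p q, p < q ∧
      IsDenseIntervalFamily p q (L.leftSlice v δ) ∧
      IsDenseIntervalFamily p q (L.rightSlice v δ) ∧
      ∀ x ∈ Ioo p q, (∃ a, x ∈ L.leftSlice v δ a) ∨ ∃ b, x ∈ L.rightSlice v δ b := by
  obtain ⟨p, q, hpq, hp, hq, hJ⟩ := exists_slice_of_mem_J h
  have hmem : ∀ {x}, x ∈ Ioo p q ↔ (x, δ) ∈ L.J v := by
    intro x
    rw [← hJ]
    rfl
  have hright : ∀ {x}, x ∈ Ioo p q → (L.T)^[v.length] (x, δ) ∉ L.Sig →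
      ∃ b, x ∈ L.rightSlice v δ b := by
    intro x hx hs
    obtain ⟨b, hb⟩ := L.exists_mem_Ia (L.iterate_mem_Ihat (hmem.mp hx)) hs
    exact ⟨b, L.mem_J_concat.mpr ⟨hmem.mp hx, hb⟩⟩
  have hleft : ∀ {x}, x ∈ Ioo p q → (x, δ) ∉ s2 '' L.Sig → ∃ a, x ∈ L.leftSlice v δ a := by
    intro x hx hs
    obtain ⟨a, ha⟩ := L.exists_mem_Ta (L.J_subset_Ihat v (hmem.mp hx)) hs
    exact ⟨a, ha, hmem.mp hx⟩
  refine ⟨p, q, hpq, ⟨fun a => ?_, fun a x hx => hmem.mpr hx.2, fun a b hab => ?_, ?_⟩,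
    ⟨fun b => L.exists_slice_eq_Ioo _ _, fun b x hx => hmem.mpr (L.mem_J_concat.mp hx).1,
      fun a b hab => ?_, ?_⟩, ?_⟩
  · obtain ⟨p', q', hpq'⟩ := L.exists_slice_eq_Ioo [Letter.inv a] (!δ)
    rw [J_singleton] at hpq'
    refine ⟨_, _, Eq.trans ?_ (Ioo_inter_Ioo (a₁ := p') (b₁ := q') (a₂ := p) (b₂ := q))⟩
    rw [← hpq', ← hJ]
    rfl
  · exact Set.disjoint_left.mpr fun x ha hb =>
      Set.disjoint_left.mp (L.disjoint_Ta hab) ha.1 hb.1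
  · intro x y hx hxy hy
    obtain ⟨z, hz, hO⟩ := exists_notMem_Ohat hnc (hp.trans hx) hxy (hy.trans hq) δ
    obtain ⟨a, ha⟩ := hleft ⟨hx.trans_lt hz.1, hz.2.trans_le hy⟩
      (notMem_image_Sig_of_notMem_Ohat hO)
    exact ⟨a, z, hz, ha⟩
  · exact Set.disjoint_left.mpr fun x ha hb => hab
      (L.eq_of_mem_Ia (L.mem_J_concat.mp ha).2 (L.mem_J_concat.mp hb).2)
  · intro x y hx hxy hy
    obtain ⟨z, hz, hO⟩ := exists_notMem_Ohat hnc (hp.trans hx) hxy (hy.trans hq) δ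
    obtain ⟨b, hb⟩ := hright ⟨hx.trans_lt hz.1, hz.2.trans_le hy⟩
      (notMem_Sig_of_notMem_Ohat hO _)
    exact ⟨b, z, hz, hb⟩
  · intro x hx
    by_cases hs : (x, δ) ∈ s2 '' L.Sig
    · exact Or.inr (hright hx fun h' => hnc ⟨_, hs, _, h'⟩)
    · exact Or.inl (hleft hx hs)

theorem slice_common_value (hnc : ¬ L.HasConnection) {v : List (Letter A)} {x : ℝ}
    {δ : Bool} (h : (x, δ) ∈ L.J v) (P Q : Letter A → Prop)
    (hPQ : ∀ a b, (L.leftSlice v δ a ∩ L.rightSlice v δ b).Nonempty → (P a ↔ Q b)) :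
    ∃ t : Prop, (∀ a, (L.leftSlice v δ a).Nonempty → (P a ↔ t)) ∧
      ∀ b, (L.rightSlice v δ b).Nonempty → (Q b ↔ t) := by
  obtain ⟨p, q, -, hL, hR, hc⟩ := exists_isDenseIntervalFamily hnc h
  exact hL.exists_common_value hR hc P Q hPQ

theorem slice_ncard_edges (hnc : ¬ L.HasConnection) {v : List (Letter A)} {x : ℝ}
    {δ : Bool} (h : (x, δ) ∈ L.J v) :
    {e : Letter A × Letter A | (L.leftSlice v δ e.1 ∩ L.rightSlice v δ e.2).Nonempty}.ncard + 1 =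
      {a | (L.leftSlice v δ a).Nonempty}.ncard + {b | (L.rightSlice v δ b).Nonempty}.ncard := by
  obtain ⟨p, q, hpq, hL, hR, hc⟩ := exists_isDenseIntervalFamily hnc h
  exact hL.ncard_edges hpq hR hc

theorem nonempty_slice_iff {B : Set (ℝ × Bool)} {δ : Bool} (h : ∀ z ∈ B, z.2 = δ) :
    {x | (x, δ) ∈ B}.Nonempty ↔ B.Nonempty := by
  constructor
  · rintro ⟨x, hx⟩
    exact ⟨_, hx⟩
  · rintro ⟨⟨x, ε⟩, hx⟩
    obtain rfl : ε = δ := h _ hx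
    exact ⟨x, hx⟩

theorem leftSlice_nonempty_iff (hnc : ¬ L.HasConnection) {v : List (Letter A)} {δ : Bool}
    (h : ∀ z ∈ L.J v, z.2 = δ) {a : Letter A} :
    (L.leftSlice v δ a).Nonempty ↔ a :: v ∈ L.lang := by
  rw [cons_mem_lang_iff hnc]
  exact nonempty_slice_iff fun z hz => h z hz.2

theorem rightSlice_nonempty_iff (hnc : ¬ L.HasConnection) {v : List (Letter A)} {δ : Bool}
    (h : ∀ z ∈ L.J v, z.2 = δ) {b : Letter A} :
    (L.rightSlice v δ b).Nonempty ↔ v ++ [b] ∈ L.lang := by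
  rw [mem_lang_iff hnc]
  exact nonempty_slice_iff fun z hz => h z (L.mem_J_concat.mp hz).1

theorem slice_inter_nonempty_iff (hnc : ¬ L.HasConnection) {v : List (Letter A)} {δ : Bool}
    (h : ∀ z ∈ L.J v, z.2 = δ) {a b : Letter A} :
    (L.leftSlice v δ a ∩ L.rightSlice v δ b).Nonempty ↔ a :: (v ++ [b]) ∈ L.lang := by
  rw [cons_mem_lang_iff hnc,
    ← nonempty_slice_iff (δ := δ) fun z hz => h z (L.mem_J_concat.mp hz.2).1]
  refine iff_of_eq (congrArg _ ?_)
  ext x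
  exact ⟨fun hx => ⟨hx.1.1, hx.2⟩, fun hx => ⟨⟨hx.1, (L.mem_J_concat.mp hx.2).1⟩, hx.2⟩⟩

theorem exists_component_of_ne_nil {v : List (Letter A)} (hv : v ≠ []) :
    ∃ δ, ∀ z ∈ L.J v, z.2 = δ := by
  cases v with
  | nil => exact absurd rfl hv
  | cons c v => exact ⟨L.comp c, fun z hz => (L.mem_Ia.mp hz.1).2⟩

theorem leftSlice_nil_nonempty_iff {δ : Bool} {a : Letter A} :
    (L.leftSlice [] δ a).Nonempty ↔ (!L.comp (Letter.inv a)) = δ := by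
  constructor
  · rintro ⟨x, hx⟩
    exact (L.mem_Ta.mp hx.1).2.symm
  · rintro rfl
    obtain ⟨x, hx⟩ := exists_between (L.end_lt (Letter.inv a))
    have : (x, !L.comp (Letter.inv a)) ∈ L.Ta a := L.mem_Ta.mpr ⟨hx, rfl⟩
    exact ⟨x, this, L.Ta_subset_Ihat a this⟩

theorem rightSlice_nil_nonempty_iff {δ : Bool} {b : Letter A} :
    (L.rightSlice [] δ b).Nonempty ↔ L.comp b = δ := by
  constructor
  · rintro ⟨x, hx⟩
    exact (L.mem_Ia.mp hx.1).2.symm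
  · rintro rfl
    obtain ⟨x, hx⟩ := exists_between (L.end_lt b)
    refine ⟨x, ?_⟩
    change (x, L.comp b) ∈ L.J [b]
    rw [J_singleton]
    exact L.mem_Ia.mpr ⟨hx, rfl⟩

theorem pair_mem_lang_iff (hnc : ¬ L.HasConnection) {a b : Letter A} :
    [a, b] ∈ L.lang ↔ ∃ δ, (L.leftSlice [] δ a ∩ L.rightSlice [] δ b).Nonempty := by
  rw [cons_mem_lang_iff hnc]
  constructor
  · rintro ⟨⟨x, δ⟩, h1, h2⟩
    exact ⟨δ, x, ⟨h1, L.J_subset_Ihat _ h2⟩, h2⟩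
  · rintro ⟨δ, x, h1, h2⟩
    exact ⟨(x, δ), h1.1, h2⟩

theorem exists_mem_J_nil (δ : Bool) : ∃ x, (x, δ) ∈ L.J [] := by
  obtain ⟨x, hx⟩ := exists_between L.lo_lt_hi
  exact ⟨x, L.mem_Ihat.mpr hx⟩

theorem ncard_pairs_mem_lang (hnc : ¬ L.HasConnection) :
    {p : Letter A × Letter A | [p.1, p.2] ∈ L.lang}.ncard + 2 = 4 * Fintype.card A := by
  let E : Bool → Set (Letter A × Letter A) :=
    fun δ => {e | (L.leftSlice [] δ e.1 ∩ L.rightSlice [] δ e.2).Nonempty}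
  have hE : {p : Letter A × Letter A | [p.1, p.2] ∈ L.lang} = E false ∪ E true := by
    ext p
    exact (pair_mem_lang_iff hnc).trans Bool.exists_bool
  have hdisj : Disjoint (E false) (E true) := by
    refine Set.disjoint_left.mpr fun e h1 h2 => ?_
    have h3 := rightSlice_nil_nonempty_iff.mp (h1.mono inter_subset_right)
    have h4 := rightSlice_nil_nonempty_iff.mp (h2.mono inter_subset_right)
    simp [h3] at h4
  have hcard : ∀ δ, (E δ).ncard + 1 =
      {a | (!L.comp (Letter.inv a)) = δ}.ncard + {b | L.comp b = δ}.ncard := by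
    intro δ
    obtain ⟨x, hx⟩ := exists_mem_J_nil (L := L) δ
    have := slice_ncard_edges hnc hx
    simpa only [leftSlice_nil_nonempty_iff, rightSlice_nil_nonempty_iff] using this
  have h1 := ncard_eq_false_add_ncard_eq_true fun a => !L.comp (Letter.inv a)
  have h2 := ncard_eq_false_add_ncard_eq_true L.comp
  rw [Fintype.card_prod, Fintype.card_bool] at h1 h2
  rw [hE, Set.ncard_union_eq hdisj]
  have h3 := hcard false
  have h4 := hcard true
  omega

/-- The natural coding of a linear involution without connection is a tree set. -/
theorem isTreeSet_lang (hnc : ¬ L.HasConnection) : IsTreeSet L.lang where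
  factorial := by
    rintro u hu v ⟨s, t, rfl⟩
    rw [mem_lang_iff hnc] at hu ⊢
    obtain ⟨z, hz⟩ := hu
    exact ⟨_, (L.mem_J_append.mp (L.mem_J_append.mp hz).1).2⟩
  inv_mem := by
    intro u hu
    rw [mem_lang_iff hnc] at hu ⊢
    obtain ⟨z, hz⟩ := hu
    exact ⟨_, (L.mem_J_wordInv hz).1⟩
  reduced := by
    intro u hu
    obtain ⟨z, hz⟩ := (mem_lang_iff hnc).mp hu
    exact L.reduced_of_mem_J hz
  letter_mem := by
    intro c
    rw [mem_lang_iff hnc, J_singleton]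
    exact L.Ia_nonempty c
  connected_nil := by
    intro P hP
    obtain ⟨x, hx⟩ := exists_mem_J_nil (L := L) true
    obtain ⟨t, h1, h2⟩ := slice_common_value hnc hx P (fun b => P (Letter.inv b))
      fun a b hab => hP a b ((pair_mem_lang_iff hnc).mpr ⟨true, hab⟩)
    have h3 : ∀ a, P a ↔ t := by
      intro a
      cases hc : L.comp (Letter.inv a) with
      | false => exact h1 a (leftSlice_nil_nonempty_iff.mpr (by rw [hc, Bool.not_false]))
      | true =>
        have := h2 (Letter.inv a) (rightSlice_nil_nonempty_iff.mpr hc)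
        rwa [Letter.inv_inv] at this
    exact fun a a' h => (h3 a').mpr ((h3 a).mp h)
  connected := by
    intro v hv P Q hPQ b b' hb hb' hQ
    obtain ⟨δ, hδ⟩ := exists_component_of_ne_nil (L := L) hv
    rw [← rightSlice_nonempty_iff hnc hδ] at hb hb'
    obtain ⟨x, hx⟩ := hb
    obtain ⟨t, -, h2⟩ := slice_common_value hnc (L.mem_J_concat.mp hx).1 P Q
      fun a b hab => hPQ a b ((slice_inter_nonempty_iff hnc hδ).mp hab)
    exact (h2 b' hb').mpr ((h2 b ⟨x, hx⟩).mp hQ)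
  card_nil := ncard_pairs_mem_lang hnc
  card := by
    intro v hv hne
    obtain ⟨δ, hδ⟩ := exists_component_of_ne_nil (L := L) hne
    obtain ⟨⟨x, ε⟩, hx⟩ := (mem_lang_iff hnc).mp hv
    obtain rfl : ε = δ := hδ _ hx
    have := slice_ncard_edges hnc hx
    simpa only [slice_inter_nonempty_iff hnc hδ, leftSlice_nonempty_iff hnc hδ,
      rightSlice_nonempty_iff hnc hδ] using this
  weight := by
    refine ⟨fun u => (lam (L.J u)).toReal, fun u => ENNReal.toReal_nonneg, fun u => ?_,
      fun u => ?_, fun u => ?_⟩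
    · rw [mem_lang_iff hnc, ← lam_J_pos_iff, ENNReal.toReal_pos_iff]
      exact (and_iff_left (lam_J_ne_top u).lt_top).symm
    · beta_reduce
      rw [← sum_lam_J_cons hnc, ENNReal.toReal_sum fun c _ => lam_J_ne_top _]
    · beta_reduce
      rw [← sum_lam_J_concat hnc, ENNReal.toReal_sum fun c _ => lam_J_ne_top _]

end LinearInvolution

/-- the set of mixed first return words to any nonempty
`w ∈ L(T)` is a symmetric basis of the free group `F_A`. -/
theorem stmt_8 {A : Type*} [Fintype A] (L : LinearInvolution A)
    (hnc : ¬ L.HasConnection) (w : List (Letter A)) (hw : w ∈ L.lang)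
    (hne : w ≠ []) :
    IsSymmetricBasisOf (FreeGroup.mk '' MR L.lang w)
      (⊤ : Subgroup (FreeGroup A)) := by
  exact (LinearInvolution.isTreeSet_lang hnc).isSymmetricBasisOf_MR hw hne

end LinInv
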